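/- arXiv:1404.1448 — 7 statements merged into one kernel-verified Lean document; each statement's English description precedes it below -/
import Mathlib

section
/- Let a_1 ∈ A_1, a_2 ∈ A_2 and i, j ∈ {1,…,M}. If i ≡ j (mod 2) and (sat_1(a_1,i) = T or sat_2(a_2,j) = T), then ‖CG(a_1,i) − CG(a_2,j)‖ ≤ 1. Otherwise (i.e., if i ≢ j (mod 2), or sat_1(a_1,i) = F and sat_2(a_2,j) = F), ‖CG(a_1,i) − CG(a_2,j)‖ ≥ 1 + 2ε. -/
noncomputable section
open Real

/-- A point of the Euclidean plane. -/
def pt (x y : ℝ) : EuclideanSpace ℝ (Fin 2) := (WithLp.equiv 2 (Fin 2 → ℝ)).symm ![x, y]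
/-- `ε = 1/1000`. -/
def eps : ℝ := 1 / 1000

/-- The points `c_{1,x}^i` (`x = true` encodes `T`, `x = false` encodes `F`). -/
def cc1 (x : Bool) (i : ℕ) : EuclideanSpace ℝ (Fin 2) :=
  pt ((i : ℝ) / 3) (if x then 1 / 2 - eps else 1 / 2 + eps)

/-- The points `c_{2,x}^i`. -/
def cc2 (x : Bool) (i : ℕ) : EuclideanSpace ℝ (Fin 2) :=
  pt ((i : ℝ) / 3) (if x then -(1 / 2) + eps else -(1 / 2) - eps)

def rr1 : EuclideanSpace ℝ (Fin 2) := pt (-(1 / 3)) (1 / 2)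
def rr2 : EuclideanSpace ℝ (Fin 2) := pt (-(1 / 3)) (-(1 / 2))

/-- The clause gadget `CG(a_1, i) = c_{1, sat_1(a_1,i)}^{i mod 2}`. -/
def CG1 {A : Type*} (sat : A → ℕ → Bool) (a : A) (i : ℕ) : EuclideanSpace ℝ (Fin 2) :=
  cc1 (sat a i) (i % 2)

/-- The clause gadget `CG(a_2, i) = c_{2, sat_2(a_2,i)}^{i mod 2}`. -/
def CG2 {A : Type*} (sat : A → ℕ → Bool) (a : A) (i : ℕ) : EuclideanSpace ℝ (Fin 2) :=
  cc2 (sat a i) (i % 2)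

/-- The assignment gadget `AG(a_1) = r_1 ∘ CG(a_1,1) ∘ ⋯ ∘ CG(a_1,M)`. -/
def AG1 {A : Type*} (M : ℕ) (sat : A → ℕ → Bool) (a : A) : List (EuclideanSpace ℝ (Fin 2)) :=
  rr1 :: (List.range M).map fun k => CG1 sat a (k + 1)

/-- The assignment gadget `AG(a_2) = r_2 ∘ CG(a_2,1) ∘ ⋯ ∘ CG(a_2,M)`. -/
def AG2 {A : Type*} (M : ℕ) (sat : A → ℕ → Bool) (a : A) : List (EuclideanSpace ℝ (Fin 2)) :=
  rr2 :: (List.range M).map fun k => CG2 sat a (k + 1)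

/-- `(a_1, a_2)` is a satisfying pair: every clause `i ∈ {1,…,M}` is satisfied by
`a_1` or by `a_2`. -/
def Satisfying {A1 A2 : Type*} (M : ℕ) (sat1 : A1 → ℕ → Bool) (sat2 : A2 → ℕ → Bool)
    (a1 : A1) (a2 : A2) : Prop :=
  ∀ i : ℕ, 1 ≤ i → i ≤ M → sat1 a1 i = true ∨ sat2 a2 i = true

lemma dist_pt (x y x' y' : ℝ) :
    dist (pt x y) (pt x' y') = √((x - x') ^ 2 + (y - y') ^ 2) := by
  simp [pt, EuclideanSpace.dist_eq, Fin.sum_univ_two, Real.dist_eq, sq_abs]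

/-- Lemma on clause gadgets: for `a_1 ∈ A_1`, `a_2 ∈ A_2` and
`i, j ∈ {1,…,M}`, if `i ≡ j (mod 2)` and (`sat_1(a_1,i) = T` or `sat_2(a_2,j) = T`)
then `‖CG(a_1,i) − CG(a_2,j)‖ ≤ 1`; otherwise `‖CG(a_1,i) − CG(a_2,j)‖ ≥ 1 + 2ε`. -/
theorem stmt0 {A1 A2 : Type*} [Fintype A1] [Fintype A2] [Nonempty A1] [Nonempty A2]
    (M : ℕ) (hM : 1 ≤ M) (sat1 : A1 → ℕ → Bool) (sat2 : A2 → ℕ → Bool)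
    (a1 : A1) (a2 : A2) (i j : ℕ)
    (hi1 : 1 ≤ i) (hiM : i ≤ M) (hj1 : 1 ≤ j) (hjM : j ≤ M) :
    (i % 2 = j % 2 ∧ (sat1 a1 i = true ∨ sat2 a2 j = true) →
      dist (CG1 sat1 a1 i) (CG2 sat2 a2 j) ≤ 1) ∧
    (¬ (i % 2 = j % 2 ∧ (sat1 a1 i = true ∨ sat2 a2 j = true)) →
      1 + 2 * eps ≤ dist (CG1 sat1 a1 i) (CG2 sat2 a2 j)) := by
  unfold CG1 CG2 cc1 cc2 eps
  rw [dist_pt]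
  refine ⟨fun ⟨hij, hsat⟩ => Real.sqrt_le_one.mpr ?_, fun h => Real.le_sqrt_of_sq_le ?_⟩
  · rw [hij]
    cases h1 : sat1 a1 i <;> cases h2 : sat2 a2 j <;> simp [h1, h2] at hsat ⊢ <;> norm_num
  · rcases Nat.mod_two_eq_zero_or_one i with hi | hi <;>
      rcases Nat.mod_two_eq_zero_or_one j with hj | hj <;>
      cases h1 : sat1 a1 i <;> cases h2 : sat2 a2 j <;>
      simp [hi, hj, h1, h2] at h ⊢ <;> norm_num
end
end

section
/- Let a_1 ∈ A_1 and a_2 ∈ A_2. If (a_1,a_2) is a satisfying pair, then the discrete Fréchet distance satisfies d_dF(AG(a_1), AG(a_2)) ≤ 1. -/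
noncomputable section
open Real

/-- A single step of a discrete traversal: advance the index in the first curve,
in the second curve, or in both, each by exactly one. -/
def IsStep (a b : ℕ × ℕ) : Prop :=
  (b.1 = a.1 + 1 ∧ b.2 = a.2) ∨ (b.1 = a.1 ∧ b.2 = a.2 + 1) ∨ (b.1 = a.1 + 1 ∧ b.2 = a.2 + 1)

/-- A discrete traversal of a pair of polygonal curves with `n` and `m` vertices
(indices are 0-based): it starts at `(0,0)`, ends at `(n-1,m-1)`, and each step
advances one index or both. -/
def IsTraversal (n m : ℕ) (T : List (ℕ × ℕ)) : Prop :=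
  T.head? = some (0, 0) ∧ T.getLast? = some (n - 1, m - 1) ∧ T.Chain' IsStep ∧
    ∀ p ∈ T, p.1 < n ∧ p.2 < m

/-- The discrete Fréchet distance of two polygonal curves, given by their
(nonempty) lists of vertices: the least `D` such that some discrete traversal
has width at most `D`. -/
def dDF {d : ℕ} (P Q : List (EuclideanSpace ℝ (Fin d))) : ℝ :=
  sInf { D | ∃ T : List (ℕ × ℕ), IsTraversal P.length Q.length T ∧
    ∀ p ∈ T, dist (P.getD p.1 0) (Q.getD p.2 0) ≤ D }
theorem dist_pt_le_one {x y z : ℝ} (h : |y - z| ≤ 1) : dist (pt x y) (pt x z) ≤ 1 := by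
  rw [EuclideanSpace.dist_eq, Fin.sum_univ_two]
  simpa [pt, Real.dist_eq, Real.sqrt_sq_eq_abs] using h

theorem dist_rr1_rr2_le_one : dist rr1 rr2 ≤ 1 :=
  dist_pt_le_one (by norm_num)

theorem dist_cc1_cc2_le_one {x y : Bool} (h : x = true ∨ y = true) (i : ℕ) :
    dist (cc1 x i) (cc2 y i) ≤ 1 := by
  apply dist_pt_le_one
  cases x <;> cases y <;> simp_all [eps] <;> norm_num [abs_le]

/-- The diagonal traversal, which advances both curves simultaneously. -/
theorem isTraversal_diagonal (n : ℕ) :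
    IsTraversal (n + 1) (n + 1) ((List.range (n + 1)).map fun i => (i, i)) := by
  refine ⟨by simp [List.head?_range], by simp [List.getLast?_range], ?_, by simp⟩
  rw [List.Chain', List.isChain_map]
  exact (List.isChain_range_succ _ _).2 fun _ _ => Or.inr (Or.inr ⟨rfl, rfl⟩)

/-- Any traversal of width at most `D` bounds the discrete Fréchet distance. -/
theorem dDF_le_of_isTraversal {d : ℕ} {P Q : List (EuclideanSpace ℝ (Fin d))} {D : ℝ}
    {T : List (ℕ × ℕ)} (hT : IsTraversal P.length Q.length T)
    (hD : ∀ p ∈ T, dist (P.getD p.1 0) (Q.getD p.2 0) ≤ D) : dDF P Q ≤ D := by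
  refine csInf_le ⟨0, ?_⟩ ⟨T, hT, hD⟩
  rintro E ⟨S, hS, hE⟩
  exact dist_nonneg.trans (hE _ (List.mem_of_mem_head? hS.1))

/-- if `(a_1, a_2)` is a satisfying pair, then
`d_dF(AG(a_1), AG(a_2)) ≤ 1`. -/
theorem stmt1 {A1 A2 : Type*} [Fintype A1] [Fintype A2] [Nonempty A1] [Nonempty A2]
    (M : ℕ) (hM : 1 ≤ M) (sat1 : A1 → ℕ → Bool) (sat2 : A2 → ℕ → Bool)
    (a1 : A1) (a2 : A2) (hsat : Satisfying M sat1 sat2 a1 a2) :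
    dDF (AG1 M sat1 a1) (AG2 M sat2 a2) ≤ 1 := by
  refine dDF_le_of_isTraversal (T := (List.range (M + 1)).map fun i => (i, i)) ?_ ?_
  · simpa [AG1, AG2] using isTraversal_diagonal M
  · simp only [List.mem_map, List.mem_range]
    rintro _ ⟨i, hi, rfl⟩
    cases i with
    | zero => simpa [AG1, AG2] using dist_rr1_rr2_le_one
    | succ k =>
      have hk : k < M := by omega
      simpa [AG1, AG2, CG1, CG2, hk] using
        dist_cc1_cc2_le_one (hsat (k + 1) (by omega) (by omega)) ((k + 1) % 2)
end
end

section
/- Let a_1 ∈ A_1 and a_2 ∈ A_2 such that (a_1,a_2) is not a satisfying pair (i.e., there is an i ∈ {1,…,M} with sat_1(a_1,i) = F and sat_2(a_2,i) = F). Then for all polygonal curves π_1, π_2 in ℝ² (possibly empty), d_dF(AG(a_1) ∘ π_1, AG(a_2) ∘ π_2) > 1 + ε. In particular d_dF(AG(a_1), AG(a_2)) > 1 + ε. -/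
noncomputable section
open Real

theorem le_dist_pt {c x y x' y' : ℝ} (h : c ^ 2 ≤ (x - x') ^ 2 + (y - y') ^ 2) :
    c ≤ dist (pt x y) (pt x' y') := by
  rw [EuclideanSpace.dist_eq]
  refine (le_abs_self c).trans (Real.abs_le_sqrt ?_)
  simpa [pt, Real.dist_eq, sq_abs] using h

theorem le_dist_cc_of_ne (x y : Bool) {i j : ℕ} (hij : i % 2 ≠ j % 2) :
    1 + 2 * eps ≤ dist (cc1 x (i % 2)) (cc2 y (j % 2)) := by
  refine le_dist_pt ?_
  rcases Nat.mod_two_eq_zero_or_one i with hi | hi <;>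
    rcases Nat.mod_two_eq_zero_or_one j with hj | hj <;>
    cases x <;> cases y <;> simp [hi, hj, eps] at hij ⊢ <;> norm_num

theorem le_dist_cc_false (i : ℕ) : 1 + 2 * eps ≤ dist (cc1 false i) (cc2 false i) := by
  refine le_dist_pt ?_
  simp [eps]
  norm_num

theorem le_dist_cc_one_rr2 (x : Bool) : 1 + 2 * eps ≤ dist (cc1 x 1) rr2 := by
  refine le_dist_pt ?_
  cases x <;> simp [eps] <;> norm_num

theorem le_dist_rr1_cc_one (x : Bool) : 1 + 2 * eps ≤ dist rr1 (cc2 x 1) := by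
  refine le_dist_pt ?_
  cases x <;> simp [eps] <;> norm_num

theorem getD_AG1_append_succ {A : Type*} {M : ℕ} (sat : A → ℕ → Bool) (a : A)
    (R : List (EuclideanSpace ℝ (Fin 2))) {k : ℕ} (hk : k < M) :
    (AG1 M sat a ++ R).getD (k + 1) 0 = CG1 sat a (k + 1) := by
  simp [AG1, List.getElem?_append, hk]

theorem getD_AG2_append_succ {A : Type*} {M : ℕ} (sat : A → ℕ → Bool) (a : A)
    (R : List (EuclideanSpace ℝ (Fin 2))) {k : ℕ} (hk : k < M) :
    (AG2 M sat a ++ R).getD (k + 1) 0 = CG2 sat a (k + 1) := by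
  simp [AG2, List.getElem?_append, hk]

/-- If the cells next to the diagonal are `bad` before `j`, and `(j, j)` is `bad`, then a chain
of steps from the diagonal to a cell beyond `j` meets a `bad` cell. -/
theorem exists_bad_of_isChain {bad : ℕ → ℕ → Prop} {a b j : ℕ} (hja : j ≤ a)
    (hoff : ∀ i < j, bad (i + 1) i ∧ bad i (i + 1)) (hdiag : bad j j) (T : List (ℕ × ℕ)) :
    ∀ k ≤ j, T.head? = some (k, k) → T.getLast? = some (a, b) → T.IsChain IsStep →
      ∃ p ∈ T, bad p.1 p.2 := by
  induction T with
  | nil => simp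
  | cons p T ih =>
    intro k hk hhead hlast hchain
    obtain rfl : p = (k, k) := by simpa using hhead
    rcases hk.eq_or_lt with rfl | hkj
    · exact ⟨_, List.mem_cons_self, hdiag⟩
    cases T with
    | nil =>
      simp at hlast
      omega
    | cons q T =>
      obtain ⟨hstep, htail⟩ := List.isChain_cons_cons.mp hchain
      obtain ⟨q1, q2⟩ := q
      rcases hstep with ⟨h1, h2⟩ | ⟨h1, h2⟩ | ⟨h1, h2⟩ <;> simp only at h1 h2 <;> subst h1 h2
      · exact ⟨(q2 + 1, q2), by simp, (hoff _ hkj).1⟩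
      · exact ⟨(q1, q1 + 1), by simp, (hoff _ hkj).2⟩
      · obtain ⟨p, hp, hbad⟩ := ih (k + 1) hkj rfl (by simpa using hlast) htail
        exact ⟨p, List.mem_cons_of_mem _ hp, hbad⟩

theorem IsTraversal.append_singleton {n m n' m' : ℕ} {T : List (ℕ × ℕ)}
    (hT : IsTraversal (n + 1) (m + 1) T) (hn : n ≤ n') (hm : m ≤ m')
    (hstep : IsStep (n, m) (n', m')) :
    IsTraversal (n' + 1) (m' + 1) (T ++ [(n', m')]) := by
  obtain ⟨hhead, hlast, hchain, hmem⟩ := hT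
  refine ⟨by simp [hhead], by simp, ?_, fun p hp => ?_⟩
  · refine List.IsChain.append hchain (List.isChain_singleton _) fun x hx y hy => ?_
    obtain rfl : (n, m) = x := by simpa [hlast] using hx
    obtain rfl : (n', m') = y := by simpa using hy
    exact hstep
  · rcases List.mem_append.mp hp with hp | hp
    · have := hmem p hp
      omega
    · obtain rfl : p = (n', m') := by simpa using hp
      simp

theorem exists_isTraversal (n m : ℕ) : ∃ T, IsTraversal (n + 1) (m + 1) T := by
  induction n with
  | succ n ih =>
    obtain ⟨T, hT⟩ := ih
    exact ⟨_, hT.append_singleton n.le_succ le_rfl (Or.inl ⟨rfl, rfl⟩)⟩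
  | zero =>
    induction m with
    | zero => exact ⟨[(0, 0)], by simp, by simp, List.isChain_singleton _, by simp⟩
    | succ m ih =>
      obtain ⟨T, hT⟩ := ih
      exact ⟨_, hT.append_singleton le_rfl m.le_succ (Or.inr (Or.inl ⟨rfl, rfl⟩))⟩

theorem le_dDF {d : ℕ} {P Q : List (EuclideanSpace ℝ (Fin d))} (hP : P ≠ []) (hQ : Q ≠ [])
    {c : ℝ} (h : ∀ T, IsTraversal P.length Q.length T →
      ∃ p ∈ T, c ≤ dist (P.getD p.1 0) (Q.getD p.2 0)) :
    c ≤ dDF P Q := by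
  refine le_csInf ?_ ?_
  · obtain ⟨T, hT⟩ := exists_isTraversal (P.length - 1) (Q.length - 1)
    rw [Nat.sub_add_cancel (List.length_pos_of_ne_nil hP),
      Nat.sub_add_cancel (List.length_pos_of_ne_nil hQ)] at hT
    obtain ⟨D, hD⟩ := ((List.finite_toSet T).image
      fun p => dist (P.getD p.1 0) (Q.getD p.2 0)).bddAbove
    exact ⟨D, T, hT, fun p hp => hD ⟨p, hp, rfl⟩⟩
  · rintro D ⟨T, hT, hD⟩
    obtain ⟨p, hp, hc⟩ := h T hT
    exact hc.trans (hD p hp)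

theorem le_dDF_AG_append {A1 A2 : Type*} {M : ℕ} {sat1 : A1 → ℕ → Bool} {sat2 : A2 → ℕ → Bool}
    {a1 : A1} {a2 : A2} (hunsat : ¬ Satisfying M sat1 sat2 a1 a2)
    (π1 π2 : List (EuclideanSpace ℝ (Fin 2))) :
    1 + 2 * eps ≤ dDF (AG1 M sat1 a1 ++ π1) (AG2 M sat2 a2 ++ π2) := by
  simp only [Satisfying, not_forall, not_or, Bool.not_eq_true] at hunsat
  obtain ⟨j, hj, hjM, hs1, hs2⟩ := hunsat
  refine le_dDF (by simp [AG1]) (by simp [AG2]) fun T ⟨hhead, hlast, hchain, _⟩ => ?_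
  refine exists_bad_of_isChain (j := j)
    (bad := fun p q => 1 + 2 * eps ≤
      dist ((AG1 M sat1 a1 ++ π1).getD p 0) ((AG2 M sat2 a2 ++ π2).getD q 0))
    ?_ (fun i hi => ?_) ?_ T 0 j.zero_le hhead hlast hchain
  · simp [AG1]
    omega
  · rw [getD_AG1_append_succ sat1 a1 π1 (hi.trans_le hjM),
      getD_AG2_append_succ sat2 a2 π2 (hi.trans_le hjM)]
    cases i with
    | zero => exact ⟨le_dist_cc_one_rr2 _, le_dist_rr1_cc_one _⟩
    | succ i =>
      rw [getD_AG1_append_succ sat1 a1 π1 (by omega), getD_AG2_append_succ sat2 a2 π2 (by omega)]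
      exact ⟨le_dist_cc_of_ne _ _ (by omega), le_dist_cc_of_ne _ _ (by omega)⟩
  · obtain ⟨i, rfl⟩ := Nat.exists_eq_add_of_le' hj
    rw [getD_AG1_append_succ sat1 a1 π1 hjM, getD_AG2_append_succ sat2 a2 π2 hjM, CG1, CG2, hs1,
      hs2]
    exact le_dist_cc_false _

/-- if `(a_1, a_2)` is not a satisfying pair, then for all polygonal
curves `π_1, π_2` (possibly empty), `d_dF(AG(a_1) ∘ π_1, AG(a_2) ∘ π_2) > 1 + ε`;
in particular `d_dF(AG(a_1), AG(a_2)) > 1 + ε`. -/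
theorem stmt2 {A1 A2 : Type*} [Fintype A1] [Fintype A2] [Nonempty A1] [Nonempty A2]
    (M : ℕ) (hM : 1 ≤ M) (sat1 : A1 → ℕ → Bool) (sat2 : A2 → ℕ → Bool)
    (a1 : A1) (a2 : A2) (hunsat : ¬ Satisfying M sat1 sat2 a1 a2) :
    (∀ π1 π2 : List (EuclideanSpace ℝ (Fin 2)),
      1 + eps < dDF (AG1 M sat1 a1 ++ π1) (AG2 M sat2 a2 ++ π2)) ∧
    1 + eps < dDF (AG1 M sat1 a1) (AG2 M sat2 a2) := by
  have heps : 1 + eps < 1 + 2 * eps := by norm_num [eps]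
  have h := fun π1 π2 => heps.trans_le (le_dDF_AG_append hunsat π1 π2)
  exact ⟨h, by simpa using h [] []⟩
end
end

section
/- If A_1 × A_2 contains a satisfying pair, then the discrete Fréchet distance satisfies d_dF(P_1, P_2) ≤ 1. -/
noncomputable section
open Real

def ss1 : EuclideanSpace ℝ (Fin 2) := pt (-(1 / 3)) (1 / 5)
def tt1 : EuclideanSpace ℝ (Fin 2) := pt (1 / 3) (1 / 5)
def ss2 : EuclideanSpace ℝ (Fin 2) := pt (-(1 / 3)) 0
def tt2 : EuclideanSpace ℝ (Fin 2) := pt (1 / 3) 0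
def ss2star : EuclideanSpace ℝ (Fin 2) := pt (-(1 / 3)) (-(4 / 5))
def tt2star : EuclideanSpace ℝ (Fin 2) := pt (1 / 3) (-(4 / 5))
/-- The curve `P_1 = ∘_{a_1 ∈ A_1} (s_1 ∘ AG(a_1) ∘ t_1)`, where `A_1` is (enumerated as)
`Fin K1`. -/
def Pone (M K1 : ℕ) (sat1 : Fin K1 → ℕ → Bool) : List (EuclideanSpace ℝ (Fin 2)) :=
  (List.finRange K1).flatMap fun a => ss1 :: (AG1 M sat1 a ++ [tt1])

/-- The curve `P_2 = s_2 ∘ s_2* ∘ (∘_{a_2 ∈ A_2} AG(a_2)) ∘ t_2* ∘ t_2`, where `A_2` is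
(enumerated as) `Fin K2`. -/
def Ptwo (M K2 : ℕ) (sat2 : Fin K2 → ℕ → Bool) : List (EuclideanSpace ℝ (Fin 2)) :=
  ss2 :: ss2star :: (((List.finRange K2).flatMap fun a => AG2 M sat2 a) ++ [tt2star, tt2])

/-- `Coupled D P Q`: the nonempty curves `P` and `Q` can be traversed jointly, keeping the
current vertices at distance at most `D`. -/
inductive Coupled {E : Type*} [PseudoMetricSpace E] (D : ℝ) : List E → List E → Prop
  | single {p q : E} (h : dist p q ≤ D) : Coupled D [p] [q]
  | left {p q : E} {P Q : List E} (h : dist p q ≤ D) (hc : Coupled D P (q :: Q)) :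
      Coupled D (p :: P) (q :: Q)
  | right {p q : E} {P Q : List E} (h : dist p q ≤ D) (hc : Coupled D (p :: P) Q) :
      Coupled D (p :: P) (q :: Q)
  | both {p q : E} {P Q : List E} (h : dist p q ≤ D) (hc : Coupled D P Q) :
      Coupled D (p :: P) (q :: Q)

namespace Coupled

variable {E : Type*} [PseudoMetricSpace E] {D : ℝ}

lemma append_left {q : E} {L P Q : List E} (h : ∀ p ∈ L, dist p q ≤ D)
    (hc : Coupled D P (q :: Q)) : Coupled D (L ++ P) (q :: Q) := by
  induction L with
  | nil => exact hc
  | cons p L ih => exact left (h p (by simp)) (ih fun x hx => h x (by simp [hx]))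

lemma append_right {p : E} {L P Q : List E} (h : ∀ q ∈ L, dist p q ≤ D)
    (hc : Coupled D (p :: P) Q) : Coupled D (p :: P) (L ++ Q) := by
  induction L with
  | nil => exact hc
  | cons q L ih => exact right (h q (by simp)) (ih fun x hx => h x (by simp [hx]))

lemma cons_singleton {p q : E} {P : List E} (h : ∀ x ∈ p :: P, dist x q ≤ D) :
    Coupled D (p :: P) [q] := by
  induction P generalizing p with
  | nil => exact single (h p (by simp))
  | cons r P ih =>
    exact left (h p (by simp)) (ih fun x hx => h x (List.mem_cons_of_mem _ hx))

lemma map_append {ι : Type*} {f g : ι → E} {L : List ι} {P Q : List E}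
    (h : ∀ i ∈ L, dist (f i) (g i) ≤ D) (hc : Coupled D P Q) :
    Coupled D (L.map f ++ P) (L.map g ++ Q) := by
  induction L with
  | nil => exact hc
  | cons i L ih => exact both (h i (by simp)) (ih fun x hx => h x (by simp [hx]))

lemma length_pos {P Q : List E} (hc : Coupled D P Q) : 0 < P.length ∧ 0 < Q.length := by
  cases hc <;> simp

end Coupled

/-- Prepending `(0, 0)` to a traversal shifted by an admissible step gives a traversal. -/
lemma IsTraversal.cons_shift {n m n' m' i j : ℕ} {T : List (ℕ × ℕ)} (hT : IsTraversal n m T)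
    (hn : 0 < n) (hm : 0 < m) (hs : IsStep (0, 0) (i, j)) (hn' : n' = n + i) (hm' : m' = m + j) :
    IsTraversal n' m' ((0, 0) :: T.map fun p => (p.1 + i, p.2 + j)) := by
  obtain ⟨h1, h2, h3, h4⟩ := hT
  subst hn' hm'
  cases T with
  | nil => simp at h1
  | cons t T =>
    simp only [List.head?_cons, Option.some.injEq] at h1
    subst h1
    refine ⟨rfl, ?_, ?_, ?_⟩
    · rw [List.map_cons, List.getLast?_cons_cons,
        ← List.map_cons (f := fun p : ℕ × ℕ => (p.1 + i, p.2 + j)), List.getLast?_map, h2]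
      simp
      omega
    · rw [List.map_cons, List.Chain', List.isChain_cons_cons]
      refine ⟨by simpa using hs, ?_⟩
      rw [← List.map_cons (f := fun p : ℕ × ℕ => (p.1 + i, p.2 + j)), List.isChain_map]
      refine h3.imp fun a b hab => ?_
      simp only [IsStep] at hab ⊢
      omega
    · simp only [List.mem_cons, List.mem_map]
      rintro p (rfl | ⟨q, hq, rfl⟩)
      · constructor <;> dsimp only <;> omega
      · have := h4 q (by simpa using hq)
        constructor <;> dsimp only <;> omega

lemma Coupled.exists_isTraversal {d : ℕ} {D : ℝ} {P Q : List (EuclideanSpace ℝ (Fin d))}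
    (hc : Coupled D P Q) : ∃ T : List (ℕ × ℕ), IsTraversal P.length Q.length T ∧
      ∀ p ∈ T, dist (P.getD p.1 0) (Q.getD p.2 0) ≤ D := by
  induction hc with
  | single h => exact ⟨[(0, 0)], by simp [IsTraversal, List.Chain'], by simpa using h⟩
  | left h hc ih =>
    obtain ⟨T, hT, hd⟩ := ih
    refine ⟨_, hT.cons_shift (i := 1) (j := 0) hc.length_pos.1 hc.length_pos.2
      (by simp [IsStep]) (by simp) (by simp), ?_⟩
    simp only [List.mem_cons, List.mem_map]
    rintro p (rfl | ⟨q, hq, rfl⟩)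
    · simpa using h
    · simpa using hd q hq
  | right h hc ih =>
    obtain ⟨T, hT, hd⟩ := ih
    refine ⟨_, hT.cons_shift (i := 0) (j := 1) hc.length_pos.1 hc.length_pos.2
      (by simp [IsStep]) (by simp) (by simp), ?_⟩
    simp only [List.mem_cons, List.mem_map]
    rintro p (rfl | ⟨q, hq, rfl⟩)
    · simpa using h
    · simpa using hd q hq
  | both h hc ih =>
    obtain ⟨T, hT, hd⟩ := ih
    refine ⟨_, hT.cons_shift (i := 1) (j := 1) hc.length_pos.1 hc.length_pos.2
      (by simp [IsStep]) (by simp) (by simp), ?_⟩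
    simp only [List.mem_cons, List.mem_map]
    rintro p (rfl | ⟨q, hq, rfl⟩)
    · simpa using h
    · simpa using hd q hq

lemma Coupled.dDF_le {d : ℕ} {D : ℝ} {P Q : List (EuclideanSpace ℝ (Fin d))}
    (hc : Coupled D P Q) : dDF P Q ≤ D := by
  refine csInf_le ⟨0, ?_⟩ hc.exists_isTraversal
  rintro x ⟨T, hT, hd⟩
  exact dist_nonneg.trans (hd _ (List.mem_of_mem_head? (by rw [hT.1]; rfl)))

lemma dist_pt_le_one_s5 {a b c d : ℝ} (h : (a - c) ^ 2 + (b - d) ^ 2 ≤ 1) :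
    dist (pt a b) (pt c d) ≤ 1 := by
  rw [EuclideanSpace.dist_eq, Real.sqrt_le_iff]
  exact ⟨zero_le_one, by simpa [pt, Fin.sum_univ_two, Real.dist_eq, sq_abs] using h⟩

/-- The axis-parallel box `[-1/3, 1/3] × [l, u]`. -/
def box (l u : ℝ) : Set (EuclideanSpace ℝ (Fin 2)) :=
  {p | ∃ x y : ℝ, p = pt x y ∧ |x| ≤ 1 / 3 ∧ l ≤ y ∧ y ≤ u}

lemma dist_le_one_of_mem_box {l u l' u' : ℝ} {p q : EuclideanSpace ℝ (Fin 2)}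
    (hp : p ∈ box l u) (hq : q ∈ box l' u') (h : u - l' ≤ 18 / 25) (h' : u' ≤ l) :
    dist p q ≤ 1 := by
  obtain ⟨x, y, rfl, hx, hy, hy'⟩ := hp
  obtain ⟨z, w, rfl, hz, hw, hw'⟩ := hq
  rw [abs_le] at hx hz
  apply dist_pt_le_one_s5
  have h1 : (x - z) ^ 2 ≤ (2 / 3) ^ 2 := sq_le_sq' (by linarith) (by linarith)
  have h2 : (y - w) ^ 2 ≤ (18 / 25) ^ 2 := sq_le_sq' (by linarith) (by linarith)
  norm_num at h1 h2 ⊢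
  linarith

lemma abs_mod_two_div_three_le (i : ℕ) : |((i % 2 : ℕ) : ℝ) / 3| ≤ 1 / 3 := by
  rcases Nat.mod_two_eq_zero_or_one i with h | h <;> rw [h] <;> norm_num

lemma CG1_mem_box {A : Type*} (sat : A → ℕ → Bool) (a : A) (i : ℕ) :
    CG1 sat a i ∈ box (1 / 5) (501 / 1000) :=
  ⟨_, _, rfl, abs_mod_two_div_three_le i, by split_ifs <;> norm_num [eps],
    by split_ifs <;> norm_num [eps]⟩

lemma CG2_mem_box {A : Type*} (sat : A → ℕ → Bool) (a : A) (i : ℕ) :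
    CG2 sat a i ∈ box (-(501 / 1000)) (-(499 / 1000)) :=
  ⟨_, _, rfl, abs_mod_two_div_three_le i, by split_ifs <;> norm_num [eps],
    by split_ifs <;> norm_num [eps]⟩

lemma ss1_mem_box : ss1 ∈ box (1 / 5) (1 / 5) :=
  ⟨_, _, rfl, by norm_num [abs_le], le_rfl, le_rfl⟩

lemma tt1_mem_box : tt1 ∈ box (1 / 5) (1 / 5) :=
  ⟨_, _, rfl, by norm_num [abs_le], le_rfl, le_rfl⟩

lemma ss2_mem_box : ss2 ∈ box 0 0 :=
  ⟨_, _, rfl, by norm_num [abs_le], le_rfl, le_rfl⟩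

lemma tt2_mem_box : tt2 ∈ box 0 0 :=
  ⟨_, _, rfl, by norm_num [abs_le], le_rfl, le_rfl⟩

lemma rr2_mem_box : rr2 ∈ box (-(501 / 1000)) (-(499 / 1000)) :=
  ⟨_, _, rfl, by norm_num [abs_le], by norm_num, by norm_num⟩

lemma mem_box_of_mem_block {A : Type*} {M : ℕ} {sat : A → ℕ → Bool} {L : List A}
    {p : EuclideanSpace ℝ (Fin 2)}
    (hp : p ∈ L.flatMap fun a => ss1 :: (AG1 M sat a ++ [tt1])) :
    p ∈ box (1 / 5) (501 / 1000) := by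
  simp only [List.mem_flatMap, AG1, List.mem_cons, List.mem_append, List.mem_map,
    List.not_mem_nil, or_false] at hp
  obtain ⟨a, -, rfl | (rfl | ⟨k, -, rfl⟩) | rfl⟩ := hp
  · exact ⟨_, _, rfl, by norm_num [abs_le], by norm_num, by norm_num⟩
  · exact ⟨_, _, rfl, by norm_num [abs_le], by norm_num, by norm_num⟩
  · exact CG1_mem_box sat a _
  · exact ⟨_, _, rfl, by norm_num [abs_le], by norm_num, by norm_num⟩

lemma mem_box_of_mem_AG2 {A : Type*} {M : ℕ} {sat : A → ℕ → Bool} {L : List A}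
    {p : EuclideanSpace ℝ (Fin 2)} (hp : p ∈ L.flatMap fun a => AG2 M sat a) :
    p ∈ box (-(501 / 1000)) (-(499 / 1000)) := by
  simp only [List.mem_flatMap, AG2, List.mem_cons, List.mem_map] at hp
  obtain ⟨a, -, rfl | ⟨k, -, rfl⟩⟩ := hp
  · exact rr2_mem_box
  · exact CG2_mem_box sat a _

lemma dist_CG1_CG2_le_one {A B : Type*} {sat1 : A → ℕ → Bool} {sat2 : B → ℕ → Bool} {a : A}
    {b : B} {i : ℕ} (h : sat1 a i = true ∨ sat2 b i = true) :
    dist (CG1 sat1 a i) (CG2 sat2 b i) ≤ 1 := by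
  apply dist_pt_le_one_s5
  cases h1 : sat1 a i <;> cases h2 : sat2 b i <;> simp_all <;> norm_num [eps]

lemma coupled_Pone_Ptwo {M K1 K2 : ℕ} {sat1 : Fin K1 → ℕ → Bool} {sat2 : Fin K2 → ℕ → Bool}
    {a1 : Fin K1} {a2 : Fin K2} (h : Satisfying M sat1 sat2 a1 a2) :
    Coupled 1 (Pone M K1 sat1) (Ptwo M K2 sat2) := by
  obtain ⟨X, Y, hXY⟩ := List.append_of_mem (List.mem_finRange a1)
  obtain ⟨U, V, hUV⟩ := List.append_of_mem (List.mem_finRange a2)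
  set F := fun a => ss1 :: (AG1 M sat1 a ++ [tt1]) with hF
  set G := fun a => AG2 M sat2 a with hG
  have hP : Pone M K1 sat1 = X.flatMap F ++ (ss1 :: rr1 ::
      ((List.range M).map (fun k => CG1 sat1 a1 (k + 1)) ++ (tt1 :: Y.flatMap F))) := by
    simp [Pone, hXY, hF, AG1]
  have hQ : Ptwo M K2 sat2 = (ss2 :: ss2star :: U.flatMap G) ++ (rr2 ::
      ((List.range M).map (fun k => CG2 sat2 a2 (k + 1)) ++
        ((V.flatMap G ++ [tt2star]) ++ [tt2]))) := by
    simp [Ptwo, hUV, hG, AG2]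
  rw [hP, hQ]
  refine Coupled.append_left (fun p hp => dist_le_one_of_mem_box (mem_box_of_mem_block hp)
    ss2_mem_box (by norm_num) (by norm_num)) ?_
  refine Coupled.append_right (L := ss2 :: ss2star :: U.flatMap G) ?_ ?_
  · simp only [List.mem_cons]
    rintro q (rfl | rfl | hq)
    · exact dist_le_one_of_mem_box ss1_mem_box ss2_mem_box (by norm_num) (by norm_num)
    · exact dist_pt_le_one_s5 (by norm_num)
    · exact dist_le_one_of_mem_box ss1_mem_box (mem_box_of_mem_AG2 hq) (by norm_num)
        (by norm_num)
  refine .left (dist_le_one_of_mem_box ss1_mem_box rr2_mem_box (by norm_num) (by norm_num)) ?_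
  refine .both (dist_pt_le_one_s5 (by norm_num)) ?_
  refine .map_append (fun k hk => dist_CG1_CG2_le_one (h _ (by omega) ?_)) ?_
  · have := List.mem_range.1 hk
    omega
  refine .append_right ?_ ?_
  · simp only [List.mem_append, List.mem_singleton]
    rintro q (hq | rfl)
    · exact dist_le_one_of_mem_box tt1_mem_box (mem_box_of_mem_AG2 hq) (by norm_num)
        (by norm_num)
    · exact dist_pt_le_one_s5 (by norm_num)
  refine .cons_singleton fun p hp => ?_
  rcases List.mem_cons.1 hp with rfl | hp
  · exact dist_le_one_of_mem_box tt1_mem_box tt2_mem_box (by norm_num) (by norm_num)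
  · exact dist_le_one_of_mem_box (mem_box_of_mem_block hp) tt2_mem_box (by norm_num)
      (by norm_num)


/-- if `A_1 × A_2` contains a satisfying pair, then
`d_dF(P_1, P_2) ≤ 1`. -/
theorem stmt5 (M K1 K2 : ℕ) (hM : 1 ≤ M) (hK1 : 1 ≤ K1) (hK2 : 1 ≤ K2)
    (sat1 : Fin K1 → ℕ → Bool) (sat2 : Fin K2 → ℕ → Bool)
    (h : ∃ a1 : Fin K1, ∃ a2 : Fin K2, Satisfying M sat1 sat2 a1 a2) :
    dDF (Pone M K1 sat1) (Ptwo M K2 sat2) ≤ 1 := by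
  obtain ⟨a1, a2, h⟩ := h
  exact (coupled_Pone_Ptwo h).dDF_le
end
end

section
/- Let a_1 ∈ A_1 and a_2 ∈ A_2, and regard AG(a_1) and AG(a_2) as continuous piecewise-linear maps on [1, M+1] (the parametrizations of the polygonal curves on their M+1 vertices). Then for all t, u ∈ [1, M+1]: if ‖AG(a_1)(t) − AG(a_2)(u)‖ ≤ 1 + ε, then ‖AG(a_2)(u) − AG(a_2)(t)‖ ≤ 1/9 and ‖AG(a_1)(t) − AG(a_1)(u)‖ ≤ 1/9. -/
noncomputable section
open Real

/-- The piecewise-linear parametrization of the polygonal curve with vertex list `P`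
(vertices `p_1, …, p_n`), defined on `[1, n]` by `P(i+λ) = (1-λ)·p_i + λ·p_{i+1}`. -/
def polyEval {d : ℕ} (P : List (EuclideanSpace ℝ (Fin d))) (t : ℝ) : EuclideanSpace ℝ (Fin d) :=
  (1 - Int.fract t) • P.getD (⌊t⌋ - 1).toNat 0 + Int.fract t • P.getD ⌊t⌋.toNat 0

/-- `φ` is a continuous nondecreasing map from `[0,1]` onto `[1,n]`. -/
def IsReparam (n : ℕ) (φ : ℝ → ℝ) : Prop :=
  ContinuousOn φ (Set.Icc 0 1) ∧ MonotoneOn φ (Set.Icc 0 1) ∧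
    φ '' Set.Icc 0 1 = Set.Icc 1 (n : ℝ)

/-- The continuous Fréchet distance of two polygonal curves, given by their
(nonempty) lists of vertices. -/
def dF {d : ℕ} (P Q : List (EuclideanSpace ℝ (Fin d))) : ℝ :=
  sInf { D | ∃ φ₁ φ₂ : ℝ → ℝ, IsReparam P.length φ₁ ∧ IsReparam Q.length φ₂ ∧
    ∀ t ∈ Set.Icc (0:ℝ) 1, dist (polyEval P (φ₁ t)) (polyEval Q (φ₂ t)) ≤ D }
/-- The common abscissa of the `k`-th vertices (counted from `0`) of the assignment gadgets. -/
def vertexX (k : ℕ) : ℝ := if k = 0 then -(1 / 3) else ((k % 2 : ℕ) : ℝ) / 3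

/-- The common abscissa of the assignment gadgets at parameter `t`. -/
def curveX (t : ℝ) : ℝ :=
  (1 - Int.fract t) * vertexX (⌊t⌋ - 1).toNat + Int.fract t * vertexX ⌊t⌋.toNat

lemma pt_apply_zero (x y : ℝ) : pt x y 0 = x := rfl

lemma pt_apply_one (x y : ℝ) : pt x y 1 = y := rfl

lemma AG1_getD {A : Type*} (M : ℕ) (sat : A → ℕ → Bool) (a : A) (k : ℕ) (hk : k ≤ M) :
    (AG1 M sat a).getD k 0 0 = vertexX k ∧ |(AG1 M sat a).getD k 0 1 - 1 / 2| ≤ eps := by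
  rcases k with _ | k
  · simp [AG1, vertexX, rr1, pt_apply_zero, pt_apply_one, eps]
  · have hk' : k < M := hk
    cases h : sat a (k + 1) <;>
      simp [AG1, vertexX, hk', CG1, cc1, pt_apply_zero, pt_apply_one, eps, h, abs_of_pos]

lemma AG2_getD {A : Type*} (M : ℕ) (sat : A → ℕ → Bool) (a : A) (k : ℕ) (hk : k ≤ M) :
    (AG2 M sat a).getD k 0 0 = vertexX k ∧ |(AG2 M sat a).getD k 0 1 - -(1 / 2)| ≤ eps := by
  rcases k with _ | k
  · simp [AG2, vertexX, rr2, pt_apply_zero, pt_apply_one, eps]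
  · have hk' : k < M := hk
    cases h : sat a (k + 1) <;>
      simp [AG2, vertexX, hk', CG2, cc2, pt_apply_zero, pt_apply_one, eps, h, abs_le] <;> norm_num

lemma polyEval_coords {M : ℕ} {P : List (EuclideanSpace ℝ (Fin 2))} {c : ℝ}
    (hP : ∀ k ≤ M, P.getD k 0 0 = vertexX k ∧ |P.getD k 0 1 - c| ≤ eps)
    {t : ℝ} (ht : t ∈ Set.Icc (1 : ℝ) ((M : ℝ) + 1)) :
    polyEval P t 0 = curveX t ∧ |polyEval P t 1 - c| ≤ eps := by
  have hf0 := Int.fract_nonneg t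
  have hf1 := (Int.fract_lt_one t).le
  have hfloor : ⌊t⌋ ≤ (M : ℤ) + 1 := by
    have : (⌊t⌋ : ℝ) ≤ M + 1 := (Int.floor_le t).trans ht.2
    exact_mod_cast this
  obtain ⟨hx, hy⟩ := hP (⌊t⌋ - 1).toNat (by omega)
  simp only [polyEval, curveX, PiLp.add_apply, PiLp.smul_apply, smul_eq_mul, hx]
  rcases hfloor.lt_or_eq with hlt | heq
  · obtain ⟨hx', hy'⟩ := hP ⌊t⌋.toNat (by omega)
    refine ⟨by rw [hx'], ?_⟩
    rw [abs_le] at hy hy' ⊢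
    constructor <;> nlinarith
  · have hfract : Int.fract t = 0 := by
      have : t - ⌊t⌋ ≤ 0 := by rw [heq]; push_cast; linarith [ht.2]
      exact le_antisymm this hf0
    simpa [hfract] using hy

/-- for `t, u ∈ [1, M+1]`, if `‖AG(a_1)(t) − AG(a_2)(u)‖ ≤ 1 + ε`
then `‖AG(a_2)(u) − AG(a_2)(t)‖ ≤ 1/9` and `‖AG(a_1)(t) − AG(a_1)(u)‖ ≤ 1/9`. -/
theorem stmt6 {A1 A2 : Type*} [Fintype A1] [Fintype A2] [Nonempty A1] [Nonempty A2]
    (M : ℕ) (hM : 1 ≤ M) (sat1 : A1 → ℕ → Bool) (sat2 : A2 → ℕ → Bool)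
    (a1 : A1) (a2 : A2) (t u : ℝ)
    (ht : t ∈ Set.Icc (1 : ℝ) ((M : ℝ) + 1)) (hu : u ∈ Set.Icc (1 : ℝ) ((M : ℝ) + 1))
    (h : dist (polyEval (AG1 M sat1 a1) t) (polyEval (AG2 M sat2 a2) u) ≤ 1 + eps) :
    dist (polyEval (AG2 M sat2 a2) u) (polyEval (AG2 M sat2 a2) t) ≤ 1 / 9 ∧
    dist (polyEval (AG1 M sat1 a1) t) (polyEval (AG1 M sat1 a1) u) ≤ 1 / 9 := by
  obtain ⟨x1t, y1t⟩ := polyEval_coords (AG1_getD M sat1 a1) ht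
  obtain ⟨x1u, y1u⟩ := polyEval_coords (AG1_getD M sat1 a1) hu
  obtain ⟨x2t, y2t⟩ := polyEval_coords (AG2_getD M sat2 a2) ht
  obtain ⟨x2u, y2u⟩ := polyEval_coords (AG2_getD M sat2 a2) hu
  simp only [EuclideanSpace.dist_eq, Fin.sum_univ_two, Real.dist_eq, sq_abs, x1t, x1u, x2t, x2u,
    eps, abs_le] at *
  rw [Real.sqrt_le_left (by norm_num)] at h
  have hx : (curveX t - curveX u) ^ 2 ≤ 6 / 1000 := by nlinarith
  constructor <;> rw [Real.sqrt_le_left (by norm_num)] <;> nlinarith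
end
end

section
/- If the continuous Fréchet distance satisfies d_F(P_1, P_2) ≤ 1 + ε = 1.001, then A_1 × A_2 contains a satisfying pair. -/
noncomputable section
open Real

/-- `X` is the piecewise linear interpolation of the values `x k` at the naturals `k`. -/
def IsInterp (x : ℕ → ℝ) (X : ℝ → ℝ) : Prop :=
  ∀ (k : ℕ) (s : ℝ), (k : ℝ) ≤ s → s ≤ k + 1 → X s = (k + 1 - s) * x k + (s - k) * x (k + 1)

theorem polyEval_interp {d : ℕ} (P : List (EuclideanSpace ℝ (Fin d))) (k : ℕ) (s : ℝ)
    (h0 : (k : ℝ) ≤ s) (h1 : s ≤ k + 1) :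
    polyEval P (s + 1) = (k + 1 - s) • P.getD k 0 + (s - k) • P.getD (k + 1) 0 := by
  rcases h1.lt_or_eq with h | h
  · have hf : ⌊s + 1⌋ = (k : ℤ) + 1 := by
      rw [Int.floor_eq_iff]
      push_cast
      constructor <;> linarith
    have hfr : Int.fract (s + 1) = s - k := by
      rw [Int.fract, hf]
      push_cast
      ring
    have e1 : ((k : ℤ) + 1 - 1).toNat = k := by lia
    have e2 : ((k : ℤ) + 1).toNat = k + 1 := by lia
    rw [polyEval, hfr, hf, e1, e2]
    congr 2
    ring
  · have hs : s + 1 = ((k + 2 : ℤ) : ℝ) := by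
      push_cast
      linarith
    have e1 : ((k : ℤ) + 2 - 1).toNat = k + 1 := by lia
    rw [polyEval, hs, Int.fract_intCast, Int.floor_intCast, e1, h]
    simp

theorem isInterp_polyEval {d : ℕ} (P : List (EuclideanSpace ℝ (Fin d))) (j : Fin d) :
    IsInterp (fun k => P.getD k 0 j) (fun s => polyEval P (s + 1) j) := by
  intro k s h0 h1
  simp [polyEval_interp P k s h0 h1]

theorem norm_getD_le_sum {d : ℕ} (P : List (EuclideanSpace ℝ (Fin d))) (k : ℕ) :
    ‖P.getD k 0‖ ≤ (P.map norm).sum := by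
  have hnn : ∀ y ∈ P.map norm, (0 : ℝ) ≤ y := by
    intro y hy
    obtain ⟨z, -, rfl⟩ := List.mem_map.1 hy
    exact norm_nonneg z
  by_cases hk : k < P.length
  · rw [List.getD_eq_getElem _ _ hk]
    exact List.single_le_sum hnn _ (List.mem_map.2 ⟨_, List.getElem_mem hk, rfl⟩)
  · rw [List.getD_eq_default _ _ (by lia)]
    simpa using List.sum_nonneg hnn

theorem norm_polyEval_le {d : ℕ} (P : List (EuclideanSpace ℝ (Fin d))) (t : ℝ) :
    ‖polyEval P t‖ ≤ (P.map norm).sum := by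
  have h0 := Int.fract_nonneg t
  have h1 := (Int.fract_lt_one t).le
  calc ‖polyEval P t‖
      ≤ (1 - Int.fract t) * ‖P.getD (⌊t⌋ - 1).toNat 0‖
          + Int.fract t * ‖P.getD ⌊t⌋.toNat 0‖ := by
        refine (norm_add_le _ _).trans ?_
        rw [norm_smul, norm_smul, Real.norm_of_nonneg h0, Real.norm_of_nonneg (sub_nonneg.2 h1)]
    _ ≤ (1 - Int.fract t) * (P.map norm).sum + Int.fract t * (P.map norm).sum := by
        gcongr
        · exact norm_getD_le_sum P _
        · exact norm_getD_le_sum P _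
    _ = (P.map norm).sum := by ring

theorem isReparam_affine {n : ℕ} (hn : 1 ≤ n) :
    IsReparam n (fun t => ((n : ℝ) - 1) * t + 1) := by
  have hn' : (1 : ℝ) ≤ n := by exact_mod_cast hn
  have hmono : MonotoneOn (fun t : ℝ => ((n : ℝ) - 1) * t + 1) (Set.Icc 0 1) := by
    intro s _ t _ hst
    have := mul_le_mul_of_nonneg_left hst (sub_nonneg.2 hn')
    simpa using this
  have hcont : ContinuousOn (fun t : ℝ => ((n : ℝ) - 1) * t + 1) (Set.Icc 0 1) := by fun_prop
  refine ⟨hcont, hmono, ?_⟩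
  apply Set.Subset.antisymm
  · rintro _ ⟨t, ht, rfl⟩
    have h0 := hmono (Set.left_mem_Icc.2 zero_le_one) ht ht.1
    have h1 := hmono ht (Set.right_mem_Icc.2 zero_le_one) ht.2
    simp only at h0 h1
    constructor <;> linarith
  · have := intermediate_value_Icc zero_le_one hcont
    simpa using this

theorem exists_reparam_of_dF_lt {d : ℕ} {P Q : List (EuclideanSpace ℝ (Fin d))} {D : ℝ}
    (hP : P ≠ []) (hQ : Q ≠ []) (h : dF P Q < D) :
    ∃ φ₁ φ₂ : ℝ → ℝ, IsReparam P.length φ₁ ∧ IsReparam Q.length φ₂ ∧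
      ∀ t ∈ Set.Icc (0 : ℝ) 1, dist (polyEval P (φ₁ t)) (polyEval Q (φ₂ t)) ≤ D := by
  have hne : { D | ∃ φ₁ φ₂ : ℝ → ℝ, IsReparam P.length φ₁ ∧ IsReparam Q.length φ₂ ∧
      ∀ t ∈ Set.Icc (0:ℝ) 1, dist (polyEval P (φ₁ t)) (polyEval Q (φ₂ t)) ≤ D }.Nonempty :=
    ⟨(P.map norm).sum + (Q.map norm).sum, _, _,
      isReparam_affine (List.length_pos_iff.2 hP), isReparam_affine (List.length_pos_iff.2 hQ),
      fun t _ => (dist_le_norm_add_norm _ _).trans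
        (add_le_add (norm_polyEval_le P _) (norm_polyEval_le Q _))⟩
  obtain ⟨E, ⟨φ₁, φ₂, h1, h2, h3⟩, hE⟩ := exists_lt_of_csInf_lt hne h
  exact ⟨φ₁, φ₂, h1, h2, fun t ht => (h3 t ht).trans hE.le⟩

theorem List.getD_flatMap_of_length_eq {α β : Type*} (f : α → List β) (m : ℕ)
    (hf : ∀ a, (f a).length = m) (z : β) :
    ∀ (l : List α) (a j : ℕ) (ha : a < l.length), j < m →
      (l.flatMap f).getD (a * m + j) z = (f l[a]).getD j z := by
  intro l
  induction l with
  | nil => intro a j ha; simp at ha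
  | cons b l ih =>
    intro a j ha hj
    rw [List.flatMap_cons]
    cases a with
    | zero =>
      rw [List.getD_append _ _ _ _ (by rw [hf]; lia)]
      simp
    | succ a =>
      have e : (a + 1) * m + j - m = a * m + j := by
        rw [Nat.succ_mul]
        lia
      rw [List.getD_append_right _ _ _ _ (by rw [hf, Nat.succ_mul]; lia), hf, e]
      exact ih a j (by simpa using ha) hj

/-- The abscissa of the `i`-th vertex of an assignment gadget. -/
def gadgetX (i : ℕ) : ℝ := if i = 0 then -(1 / 3) else ((i % 2 : ℕ) : ℝ) / 3

/-- The coordinates of the vertices of `Pone`, numbered from `0`. -/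
structure IsCurveOne (M K : ℕ) (sat : Fin K → ℕ → Bool) (x y : ℕ → ℝ) : Prop where
  start_x : ∀ a < K, x (a * (M + 3)) = -(1 / 3)
  start_y : ∀ a < K, y (a * (M + 3)) = 1 / 5
  gadget_x : ∀ a < K, ∀ i ≤ M, x (a * (M + 3) + 1 + i) = gadgetX i
  root_y : ∀ a < K, y (a * (M + 3) + 1) = 1 / 2
  clause_y : ∀ a : Fin K, ∀ i, 1 ≤ i → i ≤ M →
    y (a * (M + 3) + 1 + i) = if sat a i then 1 / 2 - eps else 1 / 2 + eps
  end_x : ∀ a < K, x (a * (M + 3) + M + 2) = 1 / 3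
  end_y : ∀ a < K, y (a * (M + 3) + M + 2) = 1 / 5

/-- The coordinates of the vertices of `Ptwo`, numbered from `0`. -/
structure IsCurveTwo (M K : ℕ) (sat : Fin K → ℕ → Bool) (x y : ℕ → ℝ) : Prop where
  start_x : x 1 = -(1 / 3)
  start_y : y 1 = -(4 / 5)
  gadget_x : ∀ b < K, ∀ i ≤ M, x (b * (M + 1) + 2 + i) = gadgetX i
  root_y : ∀ b < K, y (b * (M + 1) + 2) = -(1 / 2)
  clause_y : ∀ b : Fin K, ∀ i, 1 ≤ i → i ≤ M →
    y (b * (M + 1) + 2 + i) = if sat b i then -(1 / 2) + eps else -(1 / 2) - eps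
  end_x : x (K * (M + 1) + 2) = 1 / 3
  end_y : y (K * (M + 1) + 2) = -(4 / 5)

theorem length_AG1 {A : Type*} (M : ℕ) (sat : A → ℕ → Bool) (a : A) :
    (AG1 M sat a).length = M + 1 := by simp [AG1]

theorem length_AG2 {A : Type*} (M : ℕ) (sat : A → ℕ → Bool) (a : A) :
    (AG2 M sat a).length = M + 1 := by simp [AG2]

theorem length_Pone (M K : ℕ) (sat : Fin K → ℕ → Bool) :
    (Pone M K sat).length = K * (M + 3) := by
  simp [Pone, List.length_flatMap, length_AG1]

theorem length_Ptwo (M K : ℕ) (sat : Fin K → ℕ → Bool) :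
    (Ptwo M K sat).length = K * (M + 1) + 4 := by
  simp [Ptwo, List.length_flatMap, length_AG2]

theorem getD_AG1 {A : Type*} (M : ℕ) (sat : A → ℕ → Bool) (a : A) (i : ℕ) (hi : i < M) :
    (AG1 M sat a).getD (i + 1) 0 = CG1 sat a (i + 1) := by
  simp [AG1, hi]

theorem getD_AG2 {A : Type*} (M : ℕ) (sat : A → ℕ → Bool) (a : A) (i : ℕ) (hi : i < M) :
    (AG2 M sat a).getD (i + 1) 0 = CG2 sat a (i + 1) := by
  simp [AG2, hi]

theorem getD_Pone (M K : ℕ) (sat : Fin K → ℕ → Bool) (a : Fin K) (j : ℕ) (hj : j < M + 3) :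
    (Pone M K sat).getD (a * (M + 3) + j) 0 = (ss1 :: (AG1 M sat a ++ [tt1])).getD j 0 := by
  have := List.getD_flatMap_of_length_eq (fun a => ss1 :: (AG1 M sat a ++ [tt1])) (M + 3)
    (by simp [length_AG1]) 0 (List.finRange K) a j (by simp) hj
  simpa [Pone] using this

theorem getD_Ptwo (M K : ℕ) (sat : Fin K → ℕ → Bool) (b : Fin K) (j : ℕ) (hj : j < M + 1) :
    (Ptwo M K sat).getD (b * (M + 1) + 2 + j) 0 = (AG2 M sat b).getD j 0 := by
  have := List.getD_flatMap_of_length_eq (fun b => AG2 M sat b) (M + 1)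
    (length_AG2 M sat) 0 (List.finRange K) b j (by simp) hj
  have hlt : b * (M + 1) + j < ((List.finRange K).flatMap fun b => AG2 M sat b).length := by
    simp only [List.length_flatMap, length_AG2, List.map_const', List.sum_replicate,
      List.length_finRange, smul_eq_mul]
    have := Nat.mul_le_mul_right (M + 1) (Nat.succ_le_of_lt b.2)
    rw [Nat.succ_mul] at this
    lia
  have e : (b : ℕ) * (M + 1) + 2 + j = b * (M + 1) + j + 1 + 1 := by ring
  rw [Ptwo, e, List.getD_cons_succ, List.getD_cons_succ, List.getD_append _ _ _ _ hlt, this]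
  simp

theorem getD_Ptwo_end (M K : ℕ) (sat : Fin K → ℕ → Bool) :
    (Ptwo M K sat).getD (K * (M + 1) + 2) 0 = tt2star := by
  have hl : ((List.finRange K).flatMap fun b => AG2 M sat b).length = K * (M + 1) := by
    simp [List.length_flatMap, length_AG2]
  rw [Ptwo, List.getD_cons_succ, List.getD_cons_succ,
    List.getD_append_right _ _ _ _ hl.le, hl]
  simp

theorem isCurveOne_Pone (M K : ℕ) (sat : Fin K → ℕ → Bool) :
    IsCurveOne M K sat (fun k => (Pone M K sat).getD k 0 0)
      (fun k => (Pone M K sat).getD k 0 1) := by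
  have hs (a : Fin K) : (Pone M K sat).getD (a * (M + 3)) 0 = ss1 := by
    simpa using getD_Pone M K sat a 0 (by lia)
  have hr (a : Fin K) : (Pone M K sat).getD (a * (M + 3) + 1) 0 = rr1 := by
    simpa [AG1] using getD_Pone M K sat a 1 (by lia)
  have hc (a : Fin K) (i : ℕ) (hi : i < M) :
      (Pone M K sat).getD (a * (M + 3) + 1 + (i + 1)) 0 = CG1 sat a (i + 1) := by
    have := getD_Pone M K sat a (i + 1 + 1) (by lia)
    rw [List.getD_cons_succ, List.getD_append _ _ _ _ (by rw [length_AG1]; lia),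
      getD_AG1 M sat a i hi] at this
    rw [← this]
    congr 1
    ring
  have ht (a : Fin K) : (Pone M K sat).getD (a * (M + 3) + M + 2) 0 = tt1 := by
    have := getD_Pone M K sat a (M + 1 + 1) (by lia)
    rw [List.getD_cons_succ, List.getD_append_right _ _ _ _ (by rw [length_AG1]),
      length_AG1] at this
    simpa [add_assoc] using this
  refine ⟨fun a ha => ?_, fun a ha => ?_, fun a ha i hi => ?_, fun a ha => ?_,
    fun a i h1 hi => ?_, fun a ha => ?_, fun a ha => ?_⟩
  · simp only [hs ⟨a, ha⟩]; simp [ss1, pt]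
  · simp only [hs ⟨a, ha⟩]; simp [ss1, pt]
  · cases i with
    | zero => simp only [add_zero, hr ⟨a, ha⟩]; simp [rr1, pt, gadgetX]
    | succ i => simp only [hc ⟨a, ha⟩ i (by lia)]; simp [CG1, cc1, pt, gadgetX]
  · simp only [hr ⟨a, ha⟩]; simp [rr1, pt]
  · obtain ⟨i, rfl⟩ := Nat.exists_eq_add_of_le' h1
    simp only [hc a i (by lia)]; simp [CG1, cc1, pt]
  · simp only [ht ⟨a, ha⟩]; simp [tt1, pt]
  · simp only [ht ⟨a, ha⟩]; simp [tt1, pt]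

theorem isCurveTwo_Ptwo (M K : ℕ) (sat : Fin K → ℕ → Bool) :
    IsCurveTwo M K sat (fun k => (Ptwo M K sat).getD k 0 0)
      (fun k => (Ptwo M K sat).getD k 0 1) := by
  have hs : (Ptwo M K sat).getD 1 0 = ss2star := by simp [Ptwo]
  have hr (b : Fin K) : (Ptwo M K sat).getD (b * (M + 1) + 2) 0 = rr2 := by
    simpa [AG2] using getD_Ptwo M K sat b 0 (by lia)
  have hc (b : Fin K) (i : ℕ) (hi : i < M) :
      (Ptwo M K sat).getD (b * (M + 1) + 2 + (i + 1)) 0 = CG2 sat b (i + 1) := by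
    rw [getD_Ptwo M K sat b (i + 1) (by lia), getD_AG2 M sat b i hi]
  refine ⟨?_, ?_, fun b hb i hi => ?_, fun b hb => ?_, fun b i h1 hi => ?_, ?_, ?_⟩
  · simp only [hs]; simp [ss2star, pt]
  · simp only [hs]; simp [ss2star, pt]
  · cases i with
    | zero => simp only [add_zero, hr ⟨b, hb⟩]; simp [rr2, pt, gadgetX]
    | succ i => simp only [hc ⟨b, hb⟩ i (by lia)]; simp [CG2, cc2, pt, gadgetX]
  · simp only [hr ⟨b, hb⟩]; simp [rr2, pt]
  · obtain ⟨i, rfl⟩ := Nat.exists_eq_add_of_le' h1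
    simp only [hc b i (by lia)]; simp [CG2, cc2, pt]
  · simp only [getD_Ptwo_end]; simp [tt2star, pt]
  · simp only [getD_Ptwo_end]; simp [tt2star, pt]

theorem gadgetX_succ_nonneg (i : ℕ) : 0 ≤ gadgetX (i + 1) := by
  simp only [gadgetX, Nat.succ_ne_zero, if_false]
  positivity

theorem abs_gadgetX_sub_succ (i : ℕ) : 1 / 3 ≤ |gadgetX i - gadgetX (i + 1)| := by
  rcases i with _ | i
  · norm_num [gadgetX]
  · rcases Nat.mod_two_eq_zero_or_one i with h | h
    · have h1 : (i + 1) % 2 = 1 := by lia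
      have h2 : (i + 1 + 1) % 2 = 0 := by lia
      norm_num [gadgetX, h1, h2]
    · have h1 : (i + 1) % 2 = 0 := by lia
      have h2 : (i + 1 + 1) % 2 = 1 := by lia
      norm_num [gadgetX, h1, h2]

theorem exists_nat_mem_segment {n : ℕ} (hn : 1 ≤ n) {s : ℝ} (h0 : 0 ≤ s) (h1 : s ≤ n) :
    ∃ k < n, (k : ℝ) ≤ s ∧ s ≤ k + 1 := by
  rcases h1.lt_or_eq with h | h
  · exact ⟨⌊s⌋₊, (Nat.floor_lt h0).2 h, Nat.floor_le h0, (Nat.lt_floor_add_one s).le⟩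
  · obtain ⟨m, rfl⟩ := Nat.exists_eq_add_of_le' hn
    push_cast at h
    exact ⟨m, by lia, by linarith, by linarith⟩

namespace IsInterp

variable {x y : ℕ → ℝ} {X Y : ℝ → ℝ}

theorem apply_natCast (h : IsInterp x X) (k : ℕ) : X k = x k := by
  have := h k k le_rfl (by linarith)
  rw [this]
  ring

theorem le_of_le (h : IsInterp x X) {k : ℕ} {s c : ℝ} (h0 : (k : ℝ) ≤ s) (h1 : s ≤ k + 1)
    (ha : x k ≤ c) (hb : x (k + 1) ≤ c) : X s ≤ c := by
  rw [h k s h0 h1]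
  nlinarith [mul_le_mul_of_nonneg_left ha (by linarith : 0 ≤ k + 1 - s),
    mul_le_mul_of_nonneg_left hb (by linarith : 0 ≤ s - k)]

theorem ge_of_ge (h : IsInterp x X) {k : ℕ} {s c : ℝ} (h0 : (k : ℝ) ≤ s) (h1 : s ≤ k + 1)
    (ha : c ≤ x k) (hb : c ≤ x (k + 1)) : c ≤ X s := by
  rw [h k s h0 h1]
  nlinarith [mul_le_mul_of_nonneg_left ha (by linarith : 0 ≤ k + 1 - s),
    mul_le_mul_of_nonneg_left hb (by linarith : 0 ≤ s - k)]

/-- Moving forward on a segment brings the curve closer to the end of the segment. -/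
theorem abs_sub_le_of_le (h : IsInterp x X) {k : ℕ} {s t : ℝ} (h0 : (k : ℝ) ≤ s) (hst : s ≤ t)
    (h1 : t ≤ k + 1) : |X t - x (k + 1)| ≤ |X s - x (k + 1)| := by
  have e (u : ℝ) (h0 : (k : ℝ) ≤ u) (h1 : u ≤ k + 1) :
      |X u - x (k + 1)| = (k + 1 - u) * |x k - x (k + 1)| := by
    rw [h k u h0 h1, ← abs_of_nonneg (by linarith : 0 ≤ k + 1 - u), ← abs_mul,
      abs_of_nonneg (by linarith : 0 ≤ k + 1 - u)]
    congr 1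
    ring
  rw [e s h0 (hst.trans h1), e t (h0.trans hst) h1]
  exact mul_le_mul_of_nonneg_right (by linarith) (abs_nonneg _)

/-- On a segment ending at abscissa `x (k + 1)` and not too steep, points with abscissa close to
the end have an ordinate close to the end. -/
theorem ordinate_le_of_near_end (hX : IsInterp x X) (hY : IsInterp y Y) {k : ℕ} {s : ℝ}
    (h0 : (k : ℝ) ≤ s) (h1 : s ≤ k + 1) (hx : 1 / 3 ≤ |x k - x (k + 1)|)
    (hs : |X s - x (k + 1)| ≤ 2 / 25) (ha : y k ≤ -(499 / 1000))
    (hb : y (k + 1) ≤ -(501 / 1000)) : Y s ≤ -(5005 / 10000) := by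
  have hl : 0 ≤ k + 1 - s := by linarith
  have e : X s - x (k + 1) = (k + 1 - s) * (x k - x (k + 1)) := by
    rw [hX k s h0 h1]
    ring
  rw [e, abs_mul, abs_of_nonneg hl] at hs
  have := mul_le_mul_of_nonneg_left hx hl
  rw [hY k s h0 h1]
  nlinarith [mul_le_mul_of_nonneg_left ha hl,
    mul_le_mul_of_nonneg_left hb (by linarith : 0 ≤ s - k)]

/-- The mirror image of `ordinate_le_of_near_end`. -/
theorem ordinate_le_of_near_start (hX : IsInterp x X) (hY : IsInterp y Y) {k : ℕ} {s : ℝ}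
    (h0 : (k : ℝ) ≤ s) (h1 : s ≤ k + 1) (hx : 1 / 3 ≤ |x k - x (k + 1)|)
    (hs : |X s - x k| ≤ 2 / 25) (ha : y k ≤ -(501 / 1000))
    (hb : y (k + 1) ≤ -(499 / 1000)) : Y s ≤ -(5005 / 10000) := by
  have hl : 0 ≤ s - k := by linarith
  have e : X s - x k = -((s - k) * (x k - x (k + 1))) := by
    rw [hX k s h0 h1]
    ring
  rw [e, abs_neg, abs_mul, abs_of_nonneg hl] at hs
  have := mul_le_mul_of_nonneg_left hx hl
  rw [hY k s h0 h1]
  nlinarith [mul_le_mul_of_nonneg_left hb hl,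
    mul_le_mul_of_nonneg_left ha (by linarith : 0 ≤ k + 1 - s)]

end IsInterp

namespace IsCurveOne

variable {M K : ℕ} {sat : Fin K → ℕ → Bool} {x y : ℕ → ℝ} {X Y : ℝ → ℝ}

theorem le_gadget_y (h : IsCurveOne M K sat x y) {a i : ℕ} (ha : a < K) (hi : i ≤ M) :
    499 / 1000 ≤ y (a * (M + 3) + 1 + i) := by
  rcases Nat.eq_zero_or_pos i with rfl | hi0
  · rw [add_zero, h.root_y a ha]
    norm_num
  · rw [h.clause_y ⟨a, ha⟩ i hi0 hi, eps]
    split_ifs <;> norm_num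

theorem exists_vertex_index {k : ℕ} (hk : k < K * (M + 3)) :
    ∃ a < K, ∃ j < M + 3, k = a * (M + 3) + j :=
  ⟨k / (M + 3), Nat.div_lt_of_lt_mul (by rwa [mul_comm]), k % (M + 3),
    Nat.mod_lt _ (by lia), (Nat.div_add_mod' _ _).symm⟩

theorem vertex_y_ge (h : IsCurveOne M K sat x y) {k : ℕ} (hk : k < K * (M + 3)) :
    1 / 5 ≤ y k := by
  obtain ⟨a, ha, j, hj, rfl⟩ := exists_vertex_index hk
  rcases Nat.eq_zero_or_pos j with rfl | hj0
  · rw [add_zero, h.start_y a ha]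
  rcases (Nat.le_of_lt_succ hj).eq_or_lt with rfl | hj
  · rw [← add_assoc, h.end_y a ha]
  obtain ⟨i, rfl⟩ := Nat.exists_eq_add_of_le' hj0
  have := h.le_gadget_y (i := i) ha (by lia)
  rw [add_assoc, add_comm 1 i] at this
  linarith

theorem le_apply_y (h : IsCurveOne M K sat x y) (hY : IsInterp y Y) {s : ℝ}
    (hK : 1 ≤ K) (h0 : 0 ≤ s) (h1 : s ≤ ((K * (M + 3) - 1 : ℕ) : ℝ)) : 1 / 5 ≤ Y s := by
  have hn := Nat.mul_le_mul_right (M + 3) hK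
  obtain ⟨k, hk, hk0, hk1⟩ := exists_nat_mem_segment (by lia) h0 h1
  exact hY.ge_of_ge hk0 hk1 (h.vertex_y_ge (by lia)) (h.vertex_y_ge (by lia))

/-- The low points of the first curve are on the segments from `s_1` to `r_1`, from the last
clause gadget of a block to `t_1`, and from `t_1` to `s_1`. -/
theorem low_cases (h : IsCurveOne M K sat x y) (hX : IsInterp x X) (hY : IsInterp y Y)
    (hM : 1 ≤ M) (hK : 1 ≤ K) {s : ℝ} (h0 : 0 ≤ s) (h1 : s ≤ ((K * (M + 3) - 1 : ℕ) : ℝ))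
    (hy : Y s ≤ 9 / 40) :
    ∃ a < K, ((a : ℝ) * (M + 3) ≤ s ∧ s ≤ a * (M + 3) + 1 ∧ X s = -(1 / 3)) ∨
      ((a : ℝ) * (M + 3) + M + 1 ≤ s ∧ s ≤ a * (M + 3) + M + 2 ∧ 0 ≤ X s) ∨
      (a + 1 < K ∧ (a : ℝ) * (M + 3) + M + 2 ≤ s ∧ s ≤ a * (M + 3) + M + 3 ∧
        X s = 1 / 3 - 2 / 3 * (s - (a * (M + 3) + M + 2))) := by
  have hn := Nat.mul_le_mul_right (M + 3) hK
  obtain ⟨k, hk, hk0, hk1⟩ := exists_nat_mem_segment (by lia) h0 h1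
  obtain ⟨a, ha, j, hj, rfl⟩ := exists_vertex_index (K := K) (M := M) (k := k) (by lia)
  refine ⟨a, ha, ?_⟩
  rcases Nat.eq_zero_or_pos j with rfl | hj0
  · left
    have e := hX _ _ hk0 hk1
    have e1 := h.gadget_x a ha 0 (Nat.zero_le _)
    simp only [add_zero] at e e1 hk0 hk1
    rw [h.start_x a ha, e1, gadgetX, if_pos rfl] at e
    push_cast at hk0 hk1
    exact ⟨by linarith, by linarith, by rw [e]; ring⟩
  obtain ⟨i, rfl⟩ := Nat.exists_eq_add_of_le' hj0
  rcases lt_trichotomy i M with hi | rfl | hi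
  · exfalso
    have ha0 := h.le_gadget_y ha hi.le
    have ha1 := h.le_gadget_y ha (Nat.succ_le_of_lt hi)
    have e : a * (M + 3) + (i + 1) = a * (M + 3) + 1 + i := by ring
    rw [e] at hk0 hk1
    linarith [hY.ge_of_ge hk0 hk1 ha0 ha1]
  · right; left
    have e1 := h.gadget_x a ha i le_rfl
    have e2 := h.end_x a ha
    have e : a * (i + 3) + (i + 1) = a * (i + 3) + 1 + i := by ring
    have e' : a * (i + 3) + 1 + i + 1 = a * (i + 3) + i + 2 := by ring
    rw [e] at hk0 hk1
    obtain ⟨m, rfl⟩ := Nat.exists_eq_add_of_le' hM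
    have hm := gadgetX_succ_nonneg m
    have := hX.ge_of_ge (c := 0) hk0 hk1 (by rw [e1]; exact hm) (by rw [e', e2]; norm_num)
    push_cast at hk0 hk1 ⊢
    exact ⟨by linarith, by linarith, this⟩
  · right; right
    obtain rfl : i = M + 1 := by lia
    have haK : a + 1 < K := by
      by_contra hcon
      obtain rfl : K = a + 1 := by lia
      rw [Nat.succ_mul] at hk
      lia
    have e := hX _ _ hk0 hk1
    have e1 := h.end_x a ha
    have e2 := h.start_x (a + 1) haK
    have e3 : a * (M + 3) + (M + 1 + 1) = a * (M + 3) + M + 2 := by ring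
    have e4 : a * (M + 3) + M + 2 + 1 = (a + 1) * (M + 3) := by ring
    rw [e3, e1, e4, e2] at e
    rw [e3] at hk0 hk1
    push_cast at e hk0 hk1
    exact ⟨haK, by linarith, by linarith, by rw [e]; ring⟩

/-- Low points of the first curve far to the left are near a vertex `s_1`. -/
theorem low_left (h : IsCurveOne M K sat x y) (hX : IsInterp x X) (hY : IsInterp y Y)
    (hM : 1 ≤ M) (hK : 1 ≤ K) {s : ℝ} (h0 : 0 ≤ s) (h1 : s ≤ ((K * (M + 3) - 1 : ℕ) : ℝ))
    (hx : X s ≤ -(1 / 4)) (hy : Y s ≤ 9 / 40) :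
    ∃ a < K, (a : ℝ) * (M + 3) - 1 / 2 < s ∧ s ≤ a * (M + 3) + 1 := by
  obtain ⟨a, ha, ⟨hs0, hs1, -⟩ | ⟨-, -, hX0⟩ | ⟨ha', hs0, hs1, hXs⟩⟩ :=
    h.low_cases hX hY hM hK h0 h1 hy
  · exact ⟨a, ha, by linarith, hs1⟩
  · linarith
  · refine ⟨a + 1, ha', ?_, ?_⟩ <;> push_cast <;> linarith

/-- Low points of the first curve far to the right are near a vertex `t_1`. -/
theorem low_right (h : IsCurveOne M K sat x y) (hX : IsInterp x X) (hY : IsInterp y Y)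
    (hM : 1 ≤ M) (hK : 1 ≤ K) {s : ℝ} (h0 : 0 ≤ s) (h1 : s ≤ ((K * (M + 3) - 1 : ℕ) : ℝ))
    (hx : 1 / 4 ≤ X s) (hy : Y s ≤ 9 / 40) :
    ∃ a < K, (a : ℝ) * (M + 3) + M + 1 ≤ s ∧ s < (a + 1) * (M + 3) - 1 / 2 := by
  obtain ⟨a, ha, ⟨-, -, hXs⟩ | ⟨hs0, hs1, -⟩ | ⟨ha', hs0, hs1, hXs⟩⟩ :=
    h.low_cases hX hY hM hK h0 h1 hy
  · linarith
  · exact ⟨a, ha, hs0, by linarith⟩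
  · exact ⟨a, ha, by linarith, by linarith⟩

end IsCurveOne

namespace IsCurveTwo

variable {M K : ℕ} {sat : Fin K → ℕ → Bool} {x y : ℕ → ℝ} {X Y : ℝ → ℝ}

theorem gadget_y_le (h : IsCurveTwo M K sat x y) {b i : ℕ} (hb : b < K) (hi : i ≤ M) :
    y (b * (M + 1) + 2 + i) ≤ -(499 / 1000) := by
  rcases Nat.eq_zero_or_pos i with rfl | hi0
  · rw [add_zero, h.root_y b hb]
    norm_num
  · rw [h.clause_y ⟨b, hb⟩ i hi0 hi, eps]
    split_ifs <;> norm_num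

/-- Strictly between `s_2` and `t_2`, the second curve stays low. -/
theorem vertex_y_le (h : IsCurveTwo M K sat x y) {k : ℕ} (h1 : 1 ≤ k)
    (hk : k ≤ K * (M + 1) + 2) : y k ≤ -(499 / 1000) := by
  rcases h1.eq_or_lt with rfl | h2
  · rw [h.start_y]
    norm_num
  rcases hk.eq_or_lt with rfl | hk
  · rw [h.end_y]
    norm_num
  obtain ⟨m, rfl⟩ := Nat.exists_eq_add_of_le' (Nat.succ_le_of_lt h2)
  have hb : m / (M + 1) < K := Nat.div_lt_of_lt_mul (by rw [mul_comm]; lia)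
  have := h.gadget_y_le hb (Nat.le_of_lt_succ (Nat.mod_lt m (Nat.succ_pos M)))
  have e : m / (M + 1) * (M + 1) + 2 + m % (M + 1) = m + 2 := by
    have := Nat.div_add_mod' m (M + 1)
    lia
  rwa [e] at this

theorem apply_y_le (h : IsCurveTwo M K sat x y) (hY : IsInterp y Y) {s : ℝ} (h1 : 1 ≤ s)
    (hs : s ≤ ((K * (M + 1) + 2 : ℕ) : ℝ)) : Y s ≤ -(499 / 1000) := by
  have hs' : s - 1 ≤ ((K * (M + 1) + 1 : ℕ) : ℝ) := by
    push_cast at hs ⊢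
    linarith
  obtain ⟨k, hk, hk0, hk1⟩ := exists_nat_mem_segment (by lia) (by linarith) hs'
  refine hY.le_of_le (k := k + 1) (by push_cast; linarith) (by push_cast; linarith)
    (h.vertex_y_le (by lia) (by lia)) (h.vertex_y_le (by lia) (by lia))

/-- The vertex after the last clause gadget of a block is far from it in abscissa, or low. -/
theorem next_block (h : IsCurveTwo M K sat x y) (hM : 1 ≤ M) {b : ℕ} (hb : b < K) :
    1 / 3 ≤ |gadgetX M - x (b * (M + 1) + 2 + (M + 1))| ∨
      y (b * (M + 1) + 2 + (M + 1)) = -(4 / 5) := by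
  have e : b * (M + 1) + 2 + (M + 1) = (b + 1) * (M + 1) + 2 := by ring
  rw [e]
  rcases (Nat.succ_le_of_lt hb).eq_or_lt with rfl | hb'
  · exact Or.inr h.end_y
  · left
    have := h.gadget_x (b + 1) hb' 0 (Nat.zero_le _)
    rw [add_zero] at this
    obtain ⟨m, rfl⟩ := Nat.exists_eq_add_of_le' hM
    have hm := gadgetX_succ_nonneg m
    rw [this, le_abs]
    left
    simp only [gadgetX, if_true] at hm ⊢
    linarith

/-- A point of the second curve between `s_2*` and `t_2*` that is far to the left is on one of the
two segments at some vertex `r_2`. -/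
theorem near_root (h : IsCurveTwo M K sat x y) (hX : IsInterp x X) (hM : 1 ≤ M)
    (hK : 1 ≤ K) {s : ℝ} (h1 : 1 ≤ s) (hs : s ≤ ((K * (M + 1) + 2 : ℕ) : ℝ)) (hx : X s ≤ -(1 / 5)) :
    ∃ b < K, (b : ℝ) * (M + 1) + 1 ≤ s ∧ s ≤ b * (M + 1) + 3 := by
  have hs' : s - 1 ≤ ((K * (M + 1) + 1 : ℕ) : ℝ) := by
    push_cast at hs ⊢
    linarith
  obtain ⟨k, hk, hk0, hk1⟩ := exists_nat_mem_segment (by lia) (by linarith) hs'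
  obtain ⟨b, j, hj, hkj⟩ : ∃ b j, j < M + 1 ∧ k = b * (M + 1) + j :=
    ⟨k / (M + 1), k % (M + 1), Nat.mod_lt _ (by lia), (Nat.div_add_mod' _ _).symm⟩
  subst hkj
  have hk0' : ((b * (M + 1) + 1 + j : ℕ) : ℝ) ≤ s := by
    push_cast at hk0 ⊢
    linarith
  have hk1' : s ≤ ((b * (M + 1) + 1 + j : ℕ) : ℝ) + 1 := by
    push_cast at hk1 ⊢
    linarith
  obtain ⟨m, rfl⟩ := Nat.exists_eq_add_of_le' hM
  have hb : b ≤ K := by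
    by_contra hcon
    have := Nat.mul_le_mul_right (m + 1 + 1) (Nat.succ_le_of_lt (not_le.1 hcon))
    rw [Nat.succ_mul] at this
    lia
  rcases hb.lt_or_eq with hb | rfl
  · have hj1 : j ≤ 1 := by
      by_contra hcon
      obtain ⟨i, rfl⟩ := Nat.exists_eq_add_of_le' (not_le.1 hcon)
      have e0 := h.gadget_x b hb (i + 1) (by lia)
      have e1 := h.gadget_x b hb (i + 1 + 1) (by lia)
      have ei : b * (m + 1 + 1) + 1 + (i + (1 + 1)) = b * (m + 1 + 1) + 2 + (i + 1) := by ring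
      rw [Nat.succ_eq_add_one, ei] at hk0' hk1'
      have := hX.ge_of_ge (c := 0) hk0' hk1' (by rw [e0]; exact gadgetX_succ_nonneg _)
        (by rw [add_assoc _ (i + 1), e1]; exact gadgetX_succ_nonneg _)
      linarith
    have hj1' : (j : ℝ) ≤ 1 := by exact_mod_cast hj1
    have hj0' : (0 : ℝ) ≤ j := Nat.cast_nonneg j
    push_cast at hk0' hk1' ⊢
    exact ⟨b, hb, by linarith, by linarith⟩
  · exfalso
    obtain rfl : j = 0 := by lia
    cases b with
    | zero => lia
    | succ b =>
      have e0 := h.gadget_x b (Nat.lt_succ_self b) (m + 1) le_rfl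
      have ei : (b + 1) * (m + 1 + 1) + 1 + 0 = b * (m + 1 + 1) + 2 + (m + 1) := by ring
      have ej : b * (m + 1 + 1) + 2 + (m + 1) + 1 = (b + 1) * (m + 1 + 1) + 2 := by ring
      rw [ei] at hk0' hk1'
      have := hX.ge_of_ge (c := 0) hk0' hk1' (by rw [e0]; exact gadgetX_succ_nonneg _)
        (by rw [ej, h.end_x]; norm_num)
      linarith

end IsCurveTwo

/-- `f` and `g` traverse, during `[p, q]`, parts of two planar curves in such a way that the
points reached at the same time are at distance at most `1.00101`. -/
structure IsCoupling (X₁ Y₁ X₂ Y₂ f g : ℝ → ℝ) (p q : ℝ) : Prop where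
  cont_f : ContinuousOn f (Set.Icc p q)
  cont_g : ContinuousOn g (Set.Icc p q)
  mono_f : MonotoneOn f (Set.Icc p q)
  mono_g : MonotoneOn g (Set.Icc p q)
  sq_le : ∀ t ∈ Set.Icc p q,
    (X₁ (f t) - X₂ (g t)) ^ 2 + (Y₁ (f t) - Y₂ (g t)) ^ 2 ≤ (100101 / 100000) ^ 2

theorem abs_sub_le_of_sq_le {x₁ y₁ x₂ y₂ : ℝ}
    (h : (x₁ - x₂) ^ 2 + (y₁ - y₂) ^ 2 ≤ (100101 / 100000) ^ 2) (h₁ : 499 / 1000 ≤ y₁)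
    (h₂ : y₂ ≤ -(499 / 1000)) : |x₁ - x₂| ≤ 2 / 25 := by
  apply abs_le_of_sq_le_sq _ (by norm_num)
  nlinarith

theorem ordinate_gap_le_of_sq_le {x₁ y₁ x₂ y₂ : ℝ}
    (h : (x₁ - x₂) ^ 2 + (y₁ - y₂) ^ 2 ≤ (100101 / 100000) ^ 2) :
    y₁ - y₂ ≤ 100101 / 100000 :=
  le_of_sq_le_sq (by nlinarith [sq_nonneg (x₁ - x₂)]) (by norm_num)

theorem exists_time_apply_eq {f : ℝ → ℝ} {p q c s t : ℝ} (hf : ContinuousOn f (Set.Icc p q))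
    (hs : s ∈ Set.Icc p q) (ht : t ∈ Set.Icc p q) (hst : s ≤ t) (h0 : f s ≤ c) (h1 : c ≤ f t) :
    ∃ u ∈ Set.Icc p q, s ≤ u ∧ u ≤ t ∧ f u = c := by
  obtain ⟨u, hu, hc⟩ := intermediate_value_Icc hst
    (hf.mono (Set.Icc_subset_Icc hs.1 ht.2)) ⟨h0, h1⟩
  exact ⟨u, ⟨hs.1.trans hu.1, hu.2.trans ht.2⟩, hu.1, hu.2, hc⟩

namespace IsCoupling

variable {M K₁ K₂ : ℕ} {sat₁ : Fin K₁ → ℕ → Bool} {sat₂ : Fin K₂ → ℕ → Bool}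
  {x₁ y₁ x₂ y₂ : ℕ → ℝ} {X₁ Y₁ X₂ Y₂ f g : ℝ → ℝ} {p q : ℝ}

/-- The second curve follows the first one from one vertex of a gadget to the next one. -/
theorem step (c : IsCoupling X₁ Y₁ X₂ Y₂ f g p q)
    (h₁ : IsCurveOne M K₁ sat₁ x₁ y₁) (hX₁ : IsInterp x₁ X₁) (hY₁ : IsInterp y₁ Y₁)
    (h₂ : IsCurveTwo M K₂ sat₂ x₂ y₂) (hX₂ : IsInterp x₂ X₂) (hY₂ : IsInterp y₂ Y₂)
    (hM : 1 ≤ M) {a b i : ℕ} (ha : a < K₁) (hb : b < K₂) (hi : i < M)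
    (hlow : ∀ t ∈ Set.Icc p q, Y₂ (g t) ≤ -(499 / 1000))
    {u v : ℝ} (hu : u ∈ Set.Icc p q) (hv : v ∈ Set.Icc p q) (huv : u ≤ v)
    (hfu : f u = ((a * (M + 3) + 1 + i : ℕ) : ℝ))
    (hfv : f v = ((a * (M + 3) + 1 + (i + 1) : ℕ) : ℝ))
    (hgu0 : ((b * (M + 1) + 1 + i : ℕ) : ℝ) ≤ g u)
    (hgu1 : g u ≤ ((b * (M + 1) + 3 + i : ℕ) : ℝ)) :
    ((b * (M + 1) + 1 + (i + 1) : ℕ) : ℝ) ≤ g v ∧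
      g v ≤ ((b * (M + 1) + 3 + (i + 1) : ℕ) : ℝ) := by
  have e₁ := h₁.gadget_x a ha i hi.le
  have e₁' := h₁.gadget_x a ha (i + 1) hi
  have e₂ := h₂.gadget_x b hb i hi.le
  have e₂' := h₂.gadget_x b hb (i + 1) hi
  have hgap := abs_gadgetX_sub_succ i
  have hseg (t : ℝ) (ht : t ∈ Set.Icc p q) (hut : u ≤ t) (htv : t ≤ v) :
      ((a * (M + 3) + 1 + i : ℕ) : ℝ) ≤ f t ∧ f t ≤ ((a * (M + 3) + 1 + i : ℕ) : ℝ) + 1 := by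
    rw [← hfu]
    refine ⟨c.mono_f hu ht hut, (c.mono_f ht hv htv).trans ?_⟩
    rw [hfu, hfv]
    push_cast
    linarith
  have hhigh (t : ℝ) (ht : t ∈ Set.Icc p q) (hut : u ≤ t) (htv : t ≤ v) :
      499 / 1000 ≤ Y₁ (f t) := by
    obtain ⟨hs0, hs1⟩ := hseg t ht hut htv
    exact hY₁.ge_of_ge hs0 hs1 (h₁.le_gadget_y ha hi.le) (h₁.le_gadget_y ha hi)
  have hclose (t : ℝ) (ht : t ∈ Set.Icc p q) (hut : u ≤ t) (htv : t ≤ v) :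
      |X₁ (f t) - X₂ (g t)| ≤ 2 / 25 :=
    abs_sub_le_of_sq_le (c.sq_le t ht) (hhigh t ht hut htv) (hlow t ht)
  have hcu := hclose u hu le_rfl huv
  have hcv := hclose v hv huv le_rfl
  rw [hfu, hX₁.apply_natCast, e₁] at hcu
  rw [hfv, hX₁.apply_natCast, e₁'] at hcv
  constructor
  · by_contra! hcon
    have hd := hX₂.abs_sub_le_of_le hgu0 (c.mono_g hu hv huv)
      (by push_cast at hcon ⊢; linarith)
    have e : b * (M + 1) + 1 + i + 1 = b * (M + 1) + 2 + i := by ring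
    rw [e, e₂, abs_sub_comm (X₂ (g u))] at hd
    rw [abs_le] at hcu hcv
    have := abs_le.1 (hd.trans (abs_le.2 hcu))
    rw [le_abs] at hgap
    rcases hgap with hgap | hgap <;> linarith [hcv.1, hcv.2, this.1, this.2]
  · by_contra! hcon
    obtain ⟨w, hw, huw, hwv, hgw⟩ := exists_time_apply_eq c.cont_g hu hv huv
      (c := ((b * (M + 1) + 3 + (i + 1) : ℕ) : ℝ)) (hgu1.trans (by push_cast; linarith)) hcon.le
    obtain ⟨z, hz, huz, hzw, hgz⟩ := exists_time_apply_eq c.cont_g hu hw huw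
      (c := ((b * (M + 1) + 3 + i : ℕ) : ℝ)) hgu1 (by rw [hgw]; push_cast; linarith)
    have hcw := hclose w hw huw hwv
    have hcz := hclose z hz huz (hzw.trans hwv)
    have hd := hX₁.abs_sub_le_of_le (hseg z hz huz (hzw.trans hwv)).1
      (c.mono_f hz hw hzw) (hseg w hw huw hwv).2
    have ez : b * (M + 1) + 3 + i = b * (M + 1) + 2 + (i + 1) := by ring
    have ew : b * (M + 1) + 3 + (i + 1) = b * (M + 1) + 2 + (i + 1 + 1) := by ring
    rw [add_assoc _ i, e₁'] at hd
    rw [hgz, hX₂.apply_natCast, ez, e₂'] at hcz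
    have hfar : 1 / 3 ≤ |gadgetX (i + 1) - X₂ (g w)| ∨ Y₂ (g w) = -(4 / 5) := by
      rw [hgw, hX₂.apply_natCast, hY₂.apply_natCast, ew]
      rcases (Nat.succ_le_of_lt hi).lt_or_eq with hi' | hi'
      · left
        rw [h₂.gadget_x b hb (i + 1 + 1) hi']
        exact abs_gadgetX_sub_succ _
      · have := h₂.next_block hM hb
        rwa [← hi'] at this ⊢
    rcases hfar with hfar | hfar
    · have := abs_le.1 (hd.trans hcz)
      rw [abs_le] at hcw
      rw [le_abs] at hfar
      rcases hfar with hfar | hfar <;> linarith [hcw.1, hcw.2, this.1, this.2]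
    · linarith [ordinate_gap_le_of_sq_le (c.sq_le w hw), hhigh w hw huw hwv]

/-- While the first curve traverses a gadget, the second one traverses a gadget at the same
pace. -/
theorem exists_parallel_gadget (c : IsCoupling X₁ Y₁ X₂ Y₂ f g p q)
    (h₁ : IsCurveOne M K₁ sat₁ x₁ y₁) (hX₁ : IsInterp x₁ X₁) (hY₁ : IsInterp y₁ Y₁)
    (h₂ : IsCurveTwo M K₂ sat₂ x₂ y₂) (hX₂ : IsInterp x₂ X₂) (hY₂ : IsInterp y₂ Y₂)
    (hM : 1 ≤ M) (hK₂ : 1 ≤ K₂) (hpq : p ≤ q) {a : ℕ} (ha : a < K₁)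
    (hfp : f p ≤ ((a * (M + 3) + 1 : ℕ) : ℝ)) (hfq : ((a * (M + 3) + 1 + M : ℕ) : ℝ) ≤ f q)
    (hgp : 1 ≤ g p) (hgq : g q ≤ ((K₂ * (M + 1) + 2 : ℕ) : ℝ)) :
    ∃ b < K₂, ∀ i ≤ M, ∃ u ∈ Set.Icc p q, f u = ((a * (M + 3) + 1 + i : ℕ) : ℝ) ∧
      ((b * (M + 1) + 1 + i : ℕ) : ℝ) ≤ g u ∧ g u ≤ ((b * (M + 1) + 3 + i : ℕ) : ℝ) := by
  have hp : p ∈ Set.Icc p q := Set.left_mem_Icc.2 hpq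
  have hq : q ∈ Set.Icc p q := Set.right_mem_Icc.2 hpq
  have hg1 (t : ℝ) (ht : t ∈ Set.Icc p q) : 1 ≤ g t := hgp.trans (c.mono_g hp ht ht.1)
  have hg2 (t : ℝ) (ht : t ∈ Set.Icc p q) : g t ≤ ((K₂ * (M + 1) + 2 : ℕ) : ℝ) :=
    (c.mono_g ht hq ht.2).trans hgq
  have hlow (t : ℝ) (ht : t ∈ Set.Icc p q) : Y₂ (g t) ≤ -(499 / 1000) :=
    h₂.apply_y_le hY₂ (hg1 t ht) (hg2 t ht)
  have hvert (i : ℕ) (hi : i ≤ M) : ((a * (M + 3) + 1 + i : ℕ) : ℝ) ≤ f q :=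
    le_trans (by exact_mod_cast Nat.add_le_add_left hi _) hfq
  obtain ⟨u, hu, -, -, hfu⟩ := exists_time_apply_eq c.cont_f hp hq hpq hfp (hvert 0 (Nat.zero_le _))
  have hclose := abs_sub_le_of_sq_le (c.sq_le u hu)
    (by rw [hfu, hY₁.apply_natCast, h₁.root_y a ha]; norm_num) (hlow u hu)
  have e := h₁.gadget_x a ha 0 (Nat.zero_le _)
  rw [add_zero] at e
  rw [hfu, hX₁.apply_natCast, e, gadgetX, if_pos rfl, abs_le] at hclose
  obtain ⟨b, hb, hb0, hb1⟩ := h₂.near_root hX₂ hM hK₂ (hg1 u hu) (hg2 u hu)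
    (by linarith [hclose.1])
  refine ⟨b, hb, fun i => ?_⟩
  induction i with
  | zero =>
    intro _
    refine ⟨u, hu, hfu, ?_, ?_⟩ <;> push_cast <;> linarith
  | succ i ih =>
    intro hi
    obtain ⟨u, hu, hfu, hg0, hg1⟩ := ih (by lia)
    obtain ⟨v, hv, huv, -, hfv⟩ := exists_time_apply_eq c.cont_f hu hq hu.2
      (by rw [hfu]; push_cast; linarith) (hvert (i + 1) hi)
    exact ⟨v, hv, hfv,
      c.step h₁ hX₁ hY₁ h₂ hX₂ hY₂ hM ha hb (by lia) hlow hu hv huv hfu hfv hg0 hg1⟩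

/-- Points of two gadgets that are reached simultaneously near the `i`-th vertex cannot both
witness an unsatisfied clause. -/
theorem sat_of_near (h₁ : IsCurveOne M K₁ sat₁ x₁ y₁) (hX₁ : IsInterp x₁ X₁)
    (hY₁ : IsInterp y₁ Y₁) (h₂ : IsCurveTwo M K₂ sat₂ x₂ y₂) (hX₂ : IsInterp x₂ X₂)
    (hY₂ : IsInterp y₂ Y₂) (hM : 1 ≤ M) (a : Fin K₁) (b : Fin K₂) {i : ℕ} (hi0 : 1 ≤ i)
    (hi : i ≤ M) {s t : ℝ} (hs : s = ((a * (M + 3) + 1 + i : ℕ) : ℝ))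
    (ht0 : ((b * (M + 1) + 1 + i : ℕ) : ℝ) ≤ t) (ht1 : t ≤ ((b * (M + 1) + 3 + i : ℕ) : ℝ))
    (hlow : Y₂ t ≤ -(499 / 1000))
    (hst : (X₁ s - X₂ t) ^ 2 + (Y₁ s - Y₂ t) ^ 2 ≤ (100101 / 100000) ^ 2) :
    sat₁ a i = true ∨ sat₂ b i = true := by
  by_contra! hcon
  have hy₁ := h₁.clause_y a i hi0 hi
  have hy₂ := h₂.clause_y b i hi0 hi
  rw [if_neg hcon.1, eps] at hy₁
  rw [if_neg hcon.2, eps] at hy₂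
  have hx₁ := h₁.gadget_x a a.2 i hi
  have hx₂ := h₂.gadget_x b b.2 i hi
  have hYs : Y₁ s = 501 / 1000 := by
    rw [hs, hY₁.apply_natCast, hy₁]
    norm_num
  have hclose := abs_sub_le_of_sq_le hst (by rw [hYs]; norm_num) hlow
  rw [hs, hX₁.apply_natCast, hx₁, abs_sub_comm] at hclose
  suffices hY : Y₂ t ≤ -(5005 / 10000) by
    linarith [ordinate_gap_le_of_sq_le hst]
  obtain ⟨m, rfl⟩ := Nat.exists_eq_add_of_le' hi0
  rcases le_total t ((b * (M + 1) + 2 + (m + 1) : ℕ) : ℝ) with htk | htk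
  · have e : (b : ℕ) * (M + 1) + 1 + (m + 1) = b * (M + 1) + 2 + m := by ring
    rw [e] at ht0
    have hx₂' := h₂.gadget_x b b.2 m (by lia)
    refine hX₂.ordinate_le_of_near_end hY₂ ht0 (by push_cast at htk ⊢; linarith) ?_ ?_
      (h₂.gadget_y_le b.2 (by lia)) ?_
    · rw [add_assoc _ m, hx₂, hx₂']
      exact abs_gadgetX_sub_succ m
    · rw [add_assoc _ m, hx₂]
      exact hclose
    · rw [add_assoc _ m, hy₂]
      norm_num
  · have ht1' : t ≤ ((b * (M + 1) + 2 + (m + 1) : ℕ) : ℝ) + 1 := by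
      push_cast at ht1 ⊢
      linarith
    have hfar : 1 / 3 ≤ |gadgetX (m + 1) - x₂ (b * (M + 1) + 2 + (m + 1) + 1)| ∧
        y₂ (b * (M + 1) + 2 + (m + 1) + 1) ≤ -(499 / 1000) ∨
        y₂ (b * (M + 1) + 2 + (m + 1) + 1) = -(4 / 5) := by
      rw [add_assoc _ (m + 1)]
      rcases hi.lt_or_eq with hi' | hi'
      · left
        rw [h₂.gadget_x b b.2 (m + 1 + 1) hi']
        exact ⟨abs_gadgetX_sub_succ _, h₂.gadget_y_le b.2 hi'⟩
      · subst hi'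
        refine (h₂.next_block hM b.2).imp_left fun h => ⟨h, h₂.vertex_y_le (by lia) ?_⟩
        have := Nat.mul_le_mul_right (m + 1 + 1) (Nat.succ_le_of_lt b.2)
        rw [Nat.succ_mul] at this
        lia
    rcases hfar with ⟨hx, hy⟩ | hy
    · refine hX₂.ordinate_le_of_near_start hY₂ htk ht1' (by rwa [hx₂]) (by rwa [hx₂]) ?_ hy
      rw [hy₂]
      norm_num
    · refine hY₂.le_of_le htk ht1' ?_ ?_
      · rw [hy₂]
        norm_num
      · rw [hy]
        norm_num

theorem exists_satisfying (c : IsCoupling X₁ Y₁ X₂ Y₂ f g 0 1)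
    (h₁ : IsCurveOne M K₁ sat₁ x₁ y₁) (hX₁ : IsInterp x₁ X₁) (hY₁ : IsInterp y₁ Y₁)
    (h₂ : IsCurveTwo M K₂ sat₂ x₂ y₂) (hX₂ : IsInterp x₂ X₂) (hY₂ : IsInterp y₂ Y₂)
    (hM : 1 ≤ M) (hK₁ : 1 ≤ K₁) (hK₂ : 1 ≤ K₂)
    (hf : f '' Set.Icc 0 1 = Set.Icc 0 ((K₁ * (M + 3) - 1 : ℕ) : ℝ))
    (hg : g '' Set.Icc 0 1 = Set.Icc 0 ((K₂ * (M + 1) + 3 : ℕ) : ℝ)) :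
    ∃ a b, Satisfying M sat₁ sat₂ a b := by
  have hfm (t : ℝ) (ht : t ∈ Set.Icc (0 : ℝ) 1) : f t ∈ Set.Icc 0 ((K₁ * (M + 3) - 1 : ℕ) : ℝ) :=
    hf ▸ Set.mem_image_of_mem f ht
  have hn : (0 : ℝ) ≤ K₂ * (M + 1) := by positivity
  obtain ⟨p, hp, hgp⟩ : ((1 : ℕ) : ℝ) ∈ g '' Set.Icc 0 1 := by
    rw [hg]
    push_cast
    constructor <;> linarith
  obtain ⟨q, hq, hgq⟩ : ((K₂ * (M + 1) + 2 : ℕ) : ℝ) ∈ g '' Set.Icc 0 1 := by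
    rw [hg]
    push_cast
    constructor <;> linarith
  have hpq : p ≤ q := by
    by_contra! hcon
    have := c.mono_g hq hp hcon.le
    rw [hgp, hgq] at this
    push_cast at this
    linarith
  have hsqp := c.sq_le p hp
  have hsqq := c.sq_le q hq
  rw [hgp, hX₂.apply_natCast, hY₂.apply_natCast, h₂.start_x, h₂.start_y] at hsqp
  rw [hgq, hX₂.apply_natCast, hY₂.apply_natCast, h₂.end_x, h₂.end_y] at hsqq
  have hyp := h₁.le_apply_y hY₁ hK₁ (hfm p hp).1 (hfm p hp).2
  have hyq := h₁.le_apply_y hY₁ hK₁ (hfm q hq).1 (hfm q hq).2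
  obtain ⟨a', ha', hpa0, hpa1⟩ := h₁.low_left hX₁ hY₁ hM hK₁ (hfm p hp).1 (hfm p hp).2
    (by nlinarith) (by linarith [ordinate_gap_le_of_sq_le hsqp])
  obtain ⟨a, ha, hqa0, hqa1⟩ := h₁.low_right hX₁ hY₁ hM hK₁ (hfm q hq).1 (hfm q hq).2
    (by nlinarith) (by linarith [ordinate_gap_le_of_sq_le hsqq])
  have hle : a' ≤ a := by
    have hfpq := c.mono_f hp hq hpq
    have : (a' : ℝ) < a + 1 :=
      lt_of_mul_lt_mul_right (by linarith) (by positivity : (0 : ℝ) ≤ M + 3)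
    exact Nat.le_of_lt_succ (by exact_mod_cast this)
  have hle' : (a' : ℝ) * (M + 3) ≤ a * (M + 3) :=
    mul_le_mul_of_nonneg_right (by exact_mod_cast hle) (by positivity)
  have hsub : Set.Icc p q ⊆ Set.Icc 0 1 := Set.Icc_subset_Icc hp.1 hq.2
  have c' : IsCoupling X₁ Y₁ X₂ Y₂ f g p q :=
    ⟨c.cont_f.mono hsub, c.cont_g.mono hsub, c.mono_f.mono hsub, c.mono_g.mono hsub,
      fun t ht => c.sq_le t (hsub ht)⟩
  obtain ⟨b, hb, H⟩ := c'.exists_parallel_gadget h₁ hX₁ hY₁ h₂ hX₂ hY₂ hM hK₂ hpq ha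
    (by push_cast; linarith) (by push_cast; linarith) (by rw [hgp, Nat.cast_one]) hgq.le
  refine ⟨⟨a, ha⟩, ⟨b, hb⟩, fun i hi0 hi => ?_⟩
  obtain ⟨u, hu, hfu, hg0, hg1⟩ := H i hi
  have hgu1 := c.mono_g hp (hsub hu) hu.1
  have hgu2 := c.mono_g (hsub hu) hq hu.2
  rw [hgp, Nat.cast_one] at hgu1
  rw [hgq] at hgu2
  exact sat_of_near h₁ hX₁ hY₁ h₂ hX₂ hY₂ hM ⟨a, ha⟩ ⟨b, hb⟩ hi0 hi hfu hg0 hg1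
    (h₂.apply_y_le hY₂ hgu1 hgu2) (c'.sq_le u hu)

end IsCoupling

theorem image_sub_one_of_isReparam {n : ℕ} {φ : ℝ → ℝ} (hn : 1 ≤ n) (h : IsReparam n φ) :
    (fun t => φ t - 1) '' Set.Icc 0 1 = Set.Icc 0 ((n - 1 : ℕ) : ℝ) := by
  have e : (fun t => φ t - 1) = (fun s : ℝ => s - 1) ∘ φ := rfl
  rw [e, Set.image_comp, h.2.2, Set.image_sub_const_Icc, Nat.cast_sub hn]
  simp

/-- if the continuous Fréchet distance satisfies
`d_F(P_1, P_2) ≤ 1 + ε = 1.001`, then `A_1 × A_2` contains a satisfying pair. -/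
theorem stmt7 (M K1 K2 : ℕ) (hM : 1 ≤ M) (hK1 : 1 ≤ K1) (hK2 : 1 ≤ K2)
    (sat1 : Fin K1 → ℕ → Bool) (sat2 : Fin K2 → ℕ → Bool)
    (h : dF (Pone M K1 sat1) (Ptwo M K2 sat2) ≤ 1 + eps) :
    ∃ a1 : Fin K1, ∃ a2 : Fin K2, Satisfying M sat1 sat2 a1 a2 := by
  have hl1 : 1 ≤ (Pone M K1 sat1).length := by
    rw [length_Pone]
    exact Nat.mul_pos hK1 (by lia)
  have hl2 : 1 ≤ (Ptwo M K2 sat2).length := by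
    rw [length_Ptwo]
    lia
  obtain ⟨φ₁, φ₂, h1, h2, hD⟩ := exists_reparam_of_dF_lt (D := 100101 / 100000)
    (List.length_pos_iff.1 hl1) (List.length_pos_iff.1 hl2)
    (h.trans_lt (by norm_num [eps]))
  have hf := image_sub_one_of_isReparam hl1 h1
  have hg := image_sub_one_of_isReparam hl2 h2
  rw [length_Pone] at hf
  rw [length_Ptwo] at hg
  refine IsCoupling.exists_satisfying (f := fun t => φ₁ t - 1) (g := fun t => φ₂ t - 1)
    ⟨h1.1.sub continuousOn_const, h2.1.sub continuousOn_const, ?_, ?_, ?_⟩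
    (isCurveOne_Pone M K1 sat1) (isInterp_polyEval _ 0) (isInterp_polyEval _ 1)
    (isCurveTwo_Ptwo M K2 sat2) (isInterp_polyEval _ 0) (isInterp_polyEval _ 1)
    hM hK1 hK2 hf hg
  · exact fun s hs t ht hst => sub_le_sub_right (h1.2.1 hs ht hst) 1
  · exact fun s hs t ht hst => sub_le_sub_right (h2.2.1 hs ht hst) 1
  · intro t ht
    have hdist := hD t ht
    rw [EuclideanSpace.dist_eq, Fin.sum_univ_two, Real.dist_eq, Real.dist_eq, sq_abs, sq_abs,
      Real.sqrt_le_left (by norm_num)] at hdist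
    simpa using hdist
end
end

section
/- There exists ε_0 > 0 such that for all 0 < ε < ε_0 all of the following pairs of points in ℝ⁵ have Euclidean distance at most 1, for all a_1 ∈ A_1, a_2 ∈ A_2 and i ∈ {1,…,M}: (q, s_2) and (q, t_2) for every q ∈ Q_1; (s_1(a_1), q) for every q ∈ Q_2 ∖ {t_2*}; (t_1(a_1), q) for every q ∈ Q_2 ∖ {s_2*}; (r_1(a_1), r_2(a_2)); and (CG(a_1,i), CG(a_2,i)) whenever sat_1(a_1,i) = T or sat_2(a_2,i) = T. -/
noncomputable section
open Real

/-- A point of `ℝ⁵`. -/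
def pt5 (a b c d e : ℝ) : EuclideanSpace ℝ (Fin 5) :=
  (WithLp.equiv 2 (Fin 5 → ℝ)).symm ![a, b, c, d, e]

/-- `ρ = 1/√2`. -/
def rho : ℝ := 1 / Real.sqrt 2

/-- The point `rot(a_1^h, i)`, placed on a quarter-circle in the `(1,2)`-plane;
`M` is the number of clauses and `K1 = |A_1|`. -/
def rot1 (M K1 : ℕ) (h i : ℕ) : EuclideanSpace ℝ (Fin 5) :=
  pt5 (rho * Real.sin (π / 4 + (π / 2) * ((h * (M + 2) + i : ℕ) : ℝ) / ((K1 * (M + 2) : ℕ) : ℝ)))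
      (rho * Real.cos (π / 4 + (π / 2) * ((h * (M + 2) + i : ℕ) : ℝ) / ((K1 * (M + 2) : ℕ) : ℝ)))
      0 0 0

/-- The point `rot(a_2^h, i)`, placed on a quarter-circle in the `(3,4)`-plane;
`M` is the number of clauses and `K2 = |A_2|`. -/
def rot2 (M K2 : ℕ) (h i : ℕ) : EuclideanSpace ℝ (Fin 5) :=
  pt5 0 0
      (rho * Real.sin (π / 4 + (π / 2) * ((h * (M + 2) + i : ℕ) : ℝ) / ((K2 * (M + 2) : ℕ) : ℝ)))
      (rho * Real.cos (π / 4 + (π / 2) * ((h * (M + 2) + i : ℕ) : ℝ) / ((K2 * (M + 2) : ℕ) : ℝ)))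
      0
/-- `e_5 = (0,0,0,0,ρ)`. -/
def e5 : EuclideanSpace ℝ (Fin 5) := pt5 0 0 0 0 rho

/-- The clause gadget `CG(a_1, i)` in `ℝ⁵` (as a function of `ε`). -/
def CG5_1 (M K1 : ℕ) (sat1 : ℕ → ℕ → Bool) (ε : ℝ) (h i : ℕ) : EuclideanSpace ℝ (Fin 5) :=
  (if sat1 h i then 1 - 2 * ε else 1 + ε) • rot1 M K1 h i +
    ((i % 2 : ℕ) : ℝ) • (8 * Real.sqrt ε) • e5

/-- The clause gadget `CG(a_2, i)` in `ℝ⁵`. -/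
def CG5_2 (M K2 : ℕ) (sat2 : ℕ → ℕ → Bool) (ε : ℝ) (h i : ℕ) : EuclideanSpace ℝ (Fin 5) :=
  (if sat2 h i then 1 - 2 * ε else 1 + ε) • rot2 M K2 h i +
    ((i % 2 : ℕ) : ℝ) • (8 * Real.sqrt ε) • e5

/-- `r_1(a_1) = rot(a_1, 0) − 8√ε·e_5`. -/
def rp1 (M K1 : ℕ) (ε : ℝ) (h : ℕ) : EuclideanSpace ℝ (Fin 5) :=
  rot1 M K1 h 0 - (8 * Real.sqrt ε) • e5

/-- `r_2(a_2) = rot(a_2, 0) − 8√ε·e_5`. -/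
def rp2 (M K2 : ℕ) (ε : ℝ) (h : ℕ) : EuclideanSpace ℝ (Fin 5) :=
  rot2 M K2 h 0 - (8 * Real.sqrt ε) • e5

/-- `s_1(a_1) = (1−400ε)·rot(a_1, 0) + 10√ε·e_5`. -/
def sp1 (M K1 : ℕ) (ε : ℝ) (h : ℕ) : EuclideanSpace ℝ (Fin 5) :=
  (1 - 400 * ε) • rot1 M K1 h 0 + (10 * Real.sqrt ε) • e5

/-- `t_1(a_1) = (1−400ε)·rot(a_1, M+1) − 10√ε·e_5`. -/
def tp1 (M K1 : ℕ) (ε : ℝ) (h : ℕ) : EuclideanSpace ℝ (Fin 5) :=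
  (1 - 400 * ε) • rot1 M K1 h (M + 1) - (10 * Real.sqrt ε) • e5

/-- `s_2 = (0,0,0,0,0)`. -/
def sp2 : EuclideanSpace ℝ (Fin 5) := 0

/-- `t_2 = (0,0,0,0,0)`. -/
def tp2 : EuclideanSpace ℝ (Fin 5) := 0

/-- `s_2* = (1+9√ε)·e_5`. -/
def sp2star (ε : ℝ) : EuclideanSpace ℝ (Fin 5) := (1 + 9 * Real.sqrt ε) • e5

/-- `t_2* = −(1+9√ε)·e_5`. -/
def tp2star (ε : ℝ) : EuclideanSpace ℝ (Fin 5) := -((1 + 9 * Real.sqrt ε) • e5)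

/-- The set `Q_1` of vertices that may appear on the first curve; elements of `A_1`
are encoded by their index `h ∈ {1,…,K1}` in the enumeration. -/
def Q1 (M K1 : ℕ) (sat1 : ℕ → ℕ → Bool) (ε : ℝ) : Set (EuclideanSpace ℝ (Fin 5)) :=
  {q | ∃ h : ℕ, 1 ≤ h ∧ h ≤ K1 ∧
    (q = sp1 M K1 ε h ∨ q = tp1 M K1 ε h ∨ q = rp1 M K1 ε h ∨
      ∃ i : ℕ, 1 ≤ i ∧ i ≤ M ∧ q = CG5_1 M K1 sat1 ε h i)}

/-- The set `Q_2` of vertices that may appear on the second curve. -/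
def Q2 (M K2 : ℕ) (sat2 : ℕ → ℕ → Bool) (ε : ℝ) : Set (EuclideanSpace ℝ (Fin 5)) :=
  {q | q = sp2 ∨ q = tp2 ∨ q = sp2star ε ∨ q = tp2star ε ∨
    ∃ h : ℕ, 1 ≤ h ∧ h ≤ K2 ∧
      (q = rp2 M K2 ε h ∨ ∃ i : ℕ, 1 ≤ i ∧ i ≤ M ∧ q = CG5_2 M K2 sat2 ε h i)}

theorem rho_sq : rho ^ 2 = 1 / 2 := by
  rw [rho, div_pow, Real.sq_sqrt (by norm_num)]
  norm_num

/-- Distance criterion for points lying over the two orthogonal quarter-circles. -/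
theorem dist_rot1_rot2_le_one {M K1 M' K2 h1 i1 h2 i2 : ℕ} {c c' d d' : ℝ}
    (H : c ^ 2 + c' ^ 2 + (d - d') ^ 2 ≤ 2) :
    dist (c • rot1 M K1 h1 i1 + d • e5) (c' • rot2 M' K2 h2 i2 + d' • e5) ≤ 1 := by
  rw [EuclideanSpace.dist_eq, Real.sqrt_le_one]
  simp only [Fin.sum_univ_five, Real.dist_eq, sq_abs]
  simp only [rot1, rot2, e5, pt5, WithLp.equiv_symm_apply, PiLp.add_apply, PiLp.smul_apply,
    smul_eq_mul, Matrix.cons_val, mul_zero, add_zero, zero_add, sub_zero, zero_sub]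
  generalize π / 4 + (π / 2) * ((h1 * (M + 2) + i1 : ℕ) : ℝ) / ((K1 * (M + 2) : ℕ) : ℝ) = x
  generalize π / 4 + (π / 2) * ((h2 * (M' + 2) + i2 : ℕ) : ℝ) / ((K2 * (M' + 2) : ℕ) : ℝ) = y
  calc _ = rho ^ 2 * (c ^ 2 * (sin x ^ 2 + cos x ^ 2) + c' ^ 2 * (sin y ^ 2 + cos y ^ 2)
        + (d - d') ^ 2) := by ring
    _ ≤ 1 := by
      rw [sin_sq_add_cos_sq, sin_sq_add_cos_sq, rho_sq]
      linarith

/-- for all sufficiently small `ε > 0`, all of the listed pairs of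
points in `ℝ⁵` have Euclidean distance at most 1. Elements of `A_1` and `A_2` are
encoded by their indices `h_1 ∈ {1,…,K1}` and `h_2 ∈ {1,…,K2}`. -/
theorem stmt15 (M K1 K2 : ℕ) (hM : 1 ≤ M) (hK1 : 1 ≤ K1) (hK2 : 1 ≤ K2)
    (sat1 sat2 : ℕ → ℕ → Bool) :
    ∃ ε0 : ℝ, 0 < ε0 ∧ ∀ ε : ℝ, 0 < ε → ε < ε0 →
      (∀ q ∈ Q1 M K1 sat1 ε, dist q sp2 ≤ 1 ∧ dist q tp2 ≤ 1) ∧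
      (∀ h1 : ℕ, 1 ≤ h1 → h1 ≤ K1 → ∀ q ∈ Q2 M K2 sat2 ε, q ≠ tp2star ε →
        dist (sp1 M K1 ε h1) q ≤ 1) ∧
      (∀ h1 : ℕ, 1 ≤ h1 → h1 ≤ K1 → ∀ q ∈ Q2 M K2 sat2 ε, q ≠ sp2star ε →
        dist (tp1 M K1 ε h1) q ≤ 1) ∧
      (∀ h1 h2 : ℕ, 1 ≤ h1 → h1 ≤ K1 → 1 ≤ h2 → h2 ≤ K2 →
        dist (rp1 M K1 ε h1) (rp2 M K2 ε h2) ≤ 1) ∧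
      (∀ h1 h2 i : ℕ, 1 ≤ h1 → h1 ≤ K1 → 1 ≤ h2 → h2 ≤ K2 → 1 ≤ i → i ≤ M →
        (sat1 h1 i = true ∨ sat2 h2 i = true) →
        dist (CG5_1 M K1 sat1 ε h1 i) (CG5_2 M K2 sat2 ε h2 i) ≤ 1) := by
  refine ⟨1 / 100000, by norm_num, fun ε hε hε' => ?_⟩
  have hs : √ε ^ 2 = ε := Real.sq_sqrt hε.le
  have hs0 : 0 < √ε := Real.sqrt_pos.2 hε
  have hsq : ε ^ 2 ≤ ε / 100000 := by nlinarith
  have hs1 : √ε ≤ 1 := Real.sqrt_le_one.2 (by linarith)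
  have h_s1 (h : ℕ) : sp1 M K1 ε h = (1 - 400 * ε) • rot1 M K1 h 0 + (10 * √ε) • e5 := rfl
  have h_t1 (h : ℕ) :
      tp1 M K1 ε h = (1 - 400 * ε) • rot1 M K1 h (M + 1) + (-(10 * √ε)) • e5 := by
    rw [tp1]; module
  have h_r1 (h : ℕ) : rp1 M K1 ε h = (1 : ℝ) • rot1 M K1 h 0 + (-(8 * √ε)) • e5 := by
    rw [rp1]; module
  have h_r2 (h : ℕ) : rp2 M K2 ε h = (1 : ℝ) • rot2 M K2 h 0 + (-(8 * √ε)) • e5 := by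
    rw [rp2]; module
  have h_zero : (0 : EuclideanSpace ℝ (Fin 5)) = (0 : ℝ) • rot2 M K2 0 0 + (0 : ℝ) • e5 := by
    module
  have h_s2 : sp2star ε = (0 : ℝ) • rot2 M K2 0 0 + (1 + 9 * √ε) • e5 := by
    rw [sp2star]; module
  have h_t2 : tp2star ε = (0 : ℝ) • rot2 M K2 0 0 + (-(1 + 9 * √ε)) • e5 := by
    rw [tp2star]; module
  have h_cg1 (h i : ℕ) : CG5_1 M K1 sat1 ε h i =
      (if sat1 h i then 1 - 2 * ε else 1 + ε) • rot1 M K1 h i +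
        (((i % 2 : ℕ) : ℝ) * (8 * √ε)) • e5 := by
    rw [CG5_1, smul_smul]
  have h_cg2 (h i : ℕ) : CG5_2 M K2 sat2 ε h i =
      (if sat2 h i then 1 - 2 * ε else 1 + ε) • rot2 M K2 h i +
        (((i % 2 : ℕ) : ℝ) * (8 * √ε)) • e5 := by
    rw [CG5_2, smul_smul]
  refine ⟨?_, ?_, ?_, ?_, ?_⟩
  · rintro q ⟨h, -, -, hq⟩
    rw [sp2, tp2, and_self, h_zero]
    rcases hq with rfl | rfl | rfl | ⟨i, -, -, rfl⟩
    · rw [h_s1]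
      exact dist_rot1_rot2_le_one (by nlinarith)
    · rw [h_t1]
      exact dist_rot1_rot2_le_one (by nlinarith)
    · rw [h_r1]
      exact dist_rot1_rot2_le_one (by nlinarith)
    · rw [h_cg1]
      apply dist_rot1_rot2_le_one
      rcases Nat.mod_two_eq_zero_or_one i with hi | hi <;> rw [hi] <;> push_cast <;>
        split_ifs <;> nlinarith
  · rintro h1 - - q hq hne
    rw [h_s1]
    rcases hq with rfl | rfl | rfl | rfl | ⟨h, -, -, rfl | ⟨i, -, -, rfl⟩⟩
    · rw [sp2, h_zero]
      exact dist_rot1_rot2_le_one (by nlinarith)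
    · rw [tp2, h_zero]
      exact dist_rot1_rot2_le_one (by nlinarith)
    · rw [h_s2]
      exact dist_rot1_rot2_le_one (by nlinarith)
    · exact absurd rfl hne
    · rw [h_r2]
      exact dist_rot1_rot2_le_one (by nlinarith)
    · rw [h_cg2]
      apply dist_rot1_rot2_le_one
      rcases Nat.mod_two_eq_zero_or_one i with hi | hi <;> rw [hi] <;> push_cast <;>
        split_ifs <;> nlinarith
  · rintro h1 - - q hq hne
    rw [h_t1]
    rcases hq with rfl | rfl | rfl | rfl | ⟨h, -, -, rfl | ⟨i, -, -, rfl⟩⟩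
    · rw [sp2, h_zero]
      exact dist_rot1_rot2_le_one (by nlinarith)
    · rw [tp2, h_zero]
      exact dist_rot1_rot2_le_one (by nlinarith)
    · exact absurd rfl hne
    · rw [h_t2]
      exact dist_rot1_rot2_le_one (by nlinarith)
    · rw [h_r2]
      exact dist_rot1_rot2_le_one (by nlinarith)
    · rw [h_cg2]
      apply dist_rot1_rot2_le_one
      rcases Nat.mod_two_eq_zero_or_one i with hi | hi <;> rw [hi] <;> push_cast <;>
        split_ifs <;> nlinarith
  · rintro h1 h2 - - - -
    rw [h_r1, h_r2]
    exact dist_rot1_rot2_le_one (by norm_num)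
  · rintro h1 h2 i - - - - - - hsat
    rw [h_cg1, h_cg2]
    apply dist_rot1_rot2_le_one
    rw [sub_self]
    rcases hsat with hsat | hsat <;> rw [if_pos hsat] <;> split_ifs <;> nlinarith
end
end
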